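/- arXiv:2103.01700 — 7 statements merged into one kernel-verified Lean document; each statement's English description precedes it below -/
import Mathlib

section
/- Let β > 1 and let k be a positive integer with β^k ≥ 2. Then for μ_β-a.e. x ∈ ℝ, liminf_{r→0⁺} log μ_β(B̄(x,r)) / log r ≥ log 2 / (k log β). (In particular, dim(μ_β) ≥ log 2 / (k log β).) -/
open MeasureTheory Filter Topology

/-- `m` is the infinite product on `{0,1}^ℕ` of the uniform measure on two points:
every cylinder of length `n` has mass `2⁻ⁿ`. -/
def IsCoinMeasure (m : Measure (ℕ → Fin 2)) : Prop :=
  IsProbabilityMeasure m ∧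
  ∀ (n : ℕ) (w : Fin n → Fin 2),
    m {x | ∀ j : Fin n, x j.1 = w j} = (2 : ENNReal)⁻¹ ^ n

/-- The coding map `π_β(ε) = (1 - 1/β) ∑_{n≥0} ε_n β^{-n}` of the Bernoulli convolution. -/
noncomputable def piBeta (β : ℝ) (x : ℕ → Fin 2) : ℝ :=
  (1 - 1/β) * ∑' n : ℕ, ((x n : ℕ) : ℝ) / β ^ n

/-- A `{-1,0,1}`-combination of `1, γ⁻¹, …, γ^{-(N-1)}` with `γ ≥ 2` that is smaller than
`γ^{-(N-1)}` in absolute value is trivial. -/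
theorem digits_eq_zero_of_abs_sum_lt {γ : ℝ} (hγ : 2 ≤ γ) (d : ℕ → ℤ) (hd : ∀ i, |d i| ≤ 1) :
    ∀ N : ℕ, |∑ i ∈ Finset.range N, (d i : ℝ) * (γ⁻¹) ^ i| < γ * (γ⁻¹) ^ N →
      ∀ i < N, d i = 0 := by
  have hγ0 : 0 < γ := by linarith
  intro N
  induction N with
  | zero => intro _ i hi; omega
  | succ N ih =>
    intro h
    have hp : 0 < (γ⁻¹) ^ N := by positivity
    have hpow : γ * (γ⁻¹) ^ (N + 1) = (γ⁻¹) ^ N := by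
      rw [pow_succ]; field_simp
    rw [hpow, Finset.sum_range_succ] at h
    have hdN : |(d N : ℝ) * (γ⁻¹) ^ N| ≤ (γ⁻¹) ^ N := by
      rw [abs_mul, abs_of_pos hp]
      have : |(d N : ℝ)| ≤ 1 := by exact_mod_cast hd N
      nlinarith
    have hz : ∀ i < N, d i = 0 := by
      apply ih
      have h1 : |∑ i ∈ Finset.range N, (d i : ℝ) * (γ⁻¹) ^ i| < 2 * (γ⁻¹) ^ N := by
        rw [abs_lt] at h ⊢
        rw [abs_le] at hdN
        constructor <;> linarith [h.1, h.2, hdN.1, hdN.2]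
      nlinarith
    have hs : ∑ i ∈ Finset.range N, (d i : ℝ) * (γ⁻¹) ^ i = 0 := by
      apply Finset.sum_eq_zero
      intro i hi
      simp [hz i (Finset.mem_range.1 hi)]
    rw [hs, zero_add, abs_mul, abs_of_pos hp] at h
    have h2 : |(d N : ℝ)| < 1 := by
      by_contra! hc
      nlinarith
    have h3 : |d N| < 1 := by exact_mod_cast h2
    intro i hi
    rcases Nat.lt_succ_iff_lt_or_eq.1 hi with h' | rfl
    · exact hz i h'
    · exact Int.abs_lt_one_iff.1 h3

theorem digit_le_one (a : Fin 2) : ((a : ℕ) : ℝ) ≤ 1 := by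
  exact_mod_cast Nat.lt_succ_iff.1 a.2

theorem summable_inv_pow {β : ℝ} (hβ : 1 < β) : Summable fun n : ℕ => 1 / β ^ n := by
  simpa using summable_geometric_of_lt_one (by positivity : (0 : ℝ) ≤ β⁻¹)
    (inv_lt_one_of_one_lt₀ hβ)

theorem digit_div_le {β : ℝ} (hβ : 1 < β) (x : ℕ → Fin 2) (n : ℕ) :
    ((x n : ℕ) : ℝ) / β ^ n ≤ 1 / β ^ n := by
  have := digit_le_one (x n)
  gcongr

theorem summable_digits {β : ℝ} (hβ : 1 < β) (x : ℕ → Fin 2) :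
    Summable fun n : ℕ => ((x n : ℕ) : ℝ) / β ^ n :=
  (summable_inv_pow hβ).of_nonneg_of_le (fun n => by positivity) (digit_div_le hβ x)

theorem continuous_piBeta {β : ℝ} (hβ : 1 < β) : Continuous (piBeta β) := by
  unfold piBeta
  refine continuous_const.mul (continuous_tsum (fun n => ?_) (summable_inv_pow hβ) fun n x => ?_)
  · have : Continuous fun a : Fin 2 => ((a : ℕ) : ℝ) := continuous_of_discreteTopology
    exact (this.comp (continuous_apply n)).div_const _
  · rw [Real.norm_of_nonneg (by positivity)]
    exact digit_div_le hβ x n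

/-- The image under `piBeta` of a cylinder of length `M` lies within `β⁻ᴹ` to the right of the
truncated expansion. -/
theorem piBeta_sub_truncation_mem {β : ℝ} (hβ : 1 < β) (x : ℕ → Fin 2) (M : ℕ) :
    piBeta β x - (1 - 1 / β) * ∑ n ∈ Finset.range M, ((x n : ℕ) : ℝ) / β ^ n ∈
      Set.Icc 0 ((β ^ M)⁻¹) := by
  have hβ0 : 0 < β := by linarith
  have hc : 0 < 1 - 1 / β := by
    rw [sub_pos, div_lt_one hβ0]; exact hβ
  have hs := (summable_digits hβ x).sum_add_tsum_nat_add M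
  have hg := (summable_inv_pow hβ).mul_left (1 / β ^ M)
  have hle : ∑' n : ℕ, ((x (n + M) : ℕ) : ℝ) / β ^ (n + M) ≤
      ∑' n : ℕ, 1 / β ^ M * (1 / β ^ n) := by
    refine Summable.tsum_le_tsum (fun n => ?_)
      ((summable_nat_add_iff M).2 (summable_digits hβ x)) hg
    refine (digit_div_le hβ x (n + M)).trans (le_of_eq ?_)
    rw [pow_add]; field_simp
  have hgeo : (1 - 1 / β) * ∑' n : ℕ, 1 / β ^ M * (1 / β ^ n) = (β ^ M)⁻¹ := by
    have := tsum_geometric_of_lt_one (by positivity : (0 : ℝ) ≤ β⁻¹) (inv_lt_one_of_one_lt₀ hβ)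
    have h2 : ∑' n : ℕ, 1 / β ^ n = (1 - β⁻¹)⁻¹ := by rw [← this]; simp
    rw [tsum_mul_left, h2]
    rw [one_div] at hc ⊢
    rw [mul_comm (1 / _), ← mul_assoc, mul_inv_cancel₀ hc.ne']
    simp
  have hnn : 0 ≤ ∑' n : ℕ, ((x (n + M) : ℕ) : ℝ) / β ^ (n + M) :=
    tsum_nonneg fun n => by positivity
  unfold piBeta
  rw [← hs, ← mul_sub, add_sub_cancel_left]
  exact ⟨by positivity, hgeo ▸ by gcongr⟩

theorem IsCoinMeasure.map_closedBall_ge {β : ℝ} (hβ : 1 < β) {m : Measure (ℕ → Fin 2)}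
    (hm : IsCoinMeasure m) (y : ℕ → Fin 2) (n : ℕ) :
    (2 : ENNReal)⁻¹ ^ n ≤
      (m.map (piBeta β)) (Metric.closedBall (piBeta β y) ((β ^ n)⁻¹)) := by
  rw [Measure.map_apply (continuous_piBeta hβ).measurable Metric.isClosed_closedBall.measurableSet,
    ← hm.2 n fun j => y j]
  refine measure_mono fun x hx => ?_
  have h1 := piBeta_sub_truncation_mem hβ x n
  have h2 := piBeta_sub_truncation_mem hβ y n
  have h3 : ∑ i ∈ Finset.range n, ((x i : ℕ) : ℝ) / β ^ i =
      ∑ i ∈ Finset.range n, ((y i : ℕ) : ℝ) / β ^ i :=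
    Finset.sum_congr rfl fun i hi => by rw [hx ⟨i, Finset.mem_range.1 hi⟩]
  rw [h3] at h1
  rw [Set.mem_preimage, Metric.mem_closedBall, Real.dist_eq, abs_le]
  constructor <;> linarith [h1.1, h1.2, h2.1, h2.2]

/-- The value of a finite word, grouped into `N` blocks of length `k + 1`. -/
noncomputable def wordSum (β : ℝ) (N k : ℕ) (w : Fin (N * (k + 1)) → Fin 2) : ℝ :=
  ∑ n, ((w n : ℕ) : ℝ) / β ^ (n : ℕ)

theorem wordSum_eq_blocks (β : ℝ) (N k : ℕ) (w : Fin (N * (k + 1)) → Fin 2) :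
    wordSum β N k w =
      ∑ i : Fin N, ((w (finProdFinEquiv (i, 0)) : ℕ) : ℝ) * ((β ^ (k + 1))⁻¹) ^ (i : ℕ) +
      ∑ i : Fin N, ∑ j : Fin k, ((w (finProdFinEquiv (i, j.succ)) : ℕ) : ℝ) /
        β ^ (finProdFinEquiv (i, j.succ) : ℕ) := by
  unfold wordSum
  rw [← finProdFinEquiv.sum_comp, Fintype.sum_prod_type, ← Finset.sum_add_distrib]
  refine Finset.sum_congr rfl fun i _ => ?_
  rw [Fin.sum_univ_succ]
  congr 1
  simp [finProdFinEquiv, div_eq_mul_inv, pow_mul]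

theorem word_eq_of_abs_wordSum_sub_lt {β : ℝ} {N k : ℕ} (hγ : 2 ≤ β ^ (k + 1))
    (v w : Fin (N * (k + 1)) → Fin 2)
    (hvw : ∀ (i : Fin N) (j : Fin k),
      v (finProdFinEquiv (i, j.succ)) = w (finProdFinEquiv (i, j.succ)))
    (h : |wordSum β N k v - wordSum β N k w| < ((β ^ (k + 1))⁻¹) ^ N) : v = w := by
  set γ := β ^ (k + 1) with hγdef
  let d : ℕ → ℤ := fun i => if hi : i < N then
    ((v (finProdFinEquiv (⟨i, hi⟩, 0)) : ℕ) : ℤ) - ((w (finProdFinEquiv (⟨i, hi⟩, 0)) : ℕ) : ℤ)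
    else 0
  have hd : ∀ i, |d i| ≤ 1 := by
    intro i
    simp only [d]
    split_ifs with hi
    · rw [abs_le]; constructor <;> omega
    · simp
  have hsum : wordSum β N k v - wordSum β N k w =
      ∑ i ∈ Finset.range N, (d i : ℝ) * (γ⁻¹) ^ i := by
    rw [wordSum_eq_blocks, wordSum_eq_blocks]
    simp only [hvw, add_sub_add_right_eq_sub]
    rw [← Finset.sum_sub_distrib, Finset.sum_range]
    refine Finset.sum_congr rfl fun i _ => ?_
    simp [d, sub_mul, hγdef]
  have hp : 0 < (γ⁻¹) ^ N := by positivity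
  rw [hsum] at h
  have hz := digits_eq_zero_of_abs_sum_lt hγ d hd N (h.trans_le (by nlinarith))
  funext n
  obtain ⟨⟨i, j⟩, rfl⟩ := finProdFinEquiv.surjective n
  refine Fin.cases ?_ (fun j => hvw i j) j
  have := hz i i.2
  simp only [d, i.2, dif_pos, Fin.eta] at this
  apply Fin.ext
  omega

theorem card_words_wordSum_mem_le {β : ℝ} {k : ℕ} (hγ : 2 ≤ β ^ (k + 1)) (N C : ℕ) (a : ℝ)
    (S : Finset (Fin (N * (k + 1)) → Fin 2))
    (hS : ∀ w ∈ S, a ≤ wordSum β N k w ∧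
      wordSum β N k w < a + C * ((β ^ (k + 1))⁻¹) ^ N) :
    S.card ≤ 2 ^ (N * k) * C := by
  set δ := ((β ^ (k + 1))⁻¹) ^ N with hδ
  have hδ0 : 0 < δ := by positivity
  let f : (Fin (N * (k + 1)) → Fin 2) → (Fin N × Fin k → Fin 2) × ℕ := fun w =>
    (fun p => w (finProdFinEquiv (p.1, p.2.succ)), ⌊(wordSum β N k w - a) / δ⌋₊)
  have hcard : ((Finset.univ : Finset (Fin N × Fin k → Fin 2)) ×ˢ Finset.range C).card =
      2 ^ (N * k) * C := by
    simp [Finset.card_product]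
  rw [← hcard]
  refine Finset.card_le_card_of_injOn f (fun w hw => ?_) fun v hv w hw hvw => ?_
  · have := hS w hw
    simp only [f, Finset.coe_product, Finset.coe_univ, Set.mem_prod, Set.mem_univ, true_and,
      Finset.coe_range, Set.mem_Iio]
    rw [Nat.floor_lt (div_nonneg (by linarith [this.1]) hδ0.le), div_lt_iff₀ hδ0]
    linarith [this.2]
  · obtain ⟨h1, h2⟩ := Prod.ext_iff.1 hvw
    refine word_eq_of_abs_wordSum_sub_lt hγ v w (fun i j => congrFun h1 (i, j)) ?_
    simp only [f] at h2
    have pv : 0 ≤ (wordSum β N k v - a) / δ := div_nonneg (by linarith [(hS v hv).1]) hδ0.le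
    have pw : 0 ≤ (wordSum β N k w - a) / δ := div_nonneg (by linarith [(hS w hw).1]) hδ0.le
    have a1 := Nat.floor_le pv
    have a2 := Nat.lt_floor_add_one ((wordSum β N k v - a) / δ)
    have b1 := Nat.floor_le pw
    have b2 := Nat.lt_floor_add_one ((wordSum β N k w - a) / δ)
    rw [h2] at a1 a2
    have key : |(wordSum β N k v - a) / δ - (wordSum β N k w - a) / δ| < 1 := by
      rw [abs_lt]; constructor <;> linarith
    rw [← sub_div, sub_sub_sub_cancel_right, abs_div, abs_of_pos hδ0, div_lt_one hδ0] at key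
    exact key

/-- Uniform Frostman bound: balls of radius `β^{-kN}` have mass `O(2⁻ᴺ)`. -/
theorem IsCoinMeasure.exists_map_closedBall_le {β : ℝ} (hβ : 1 < β) {k : ℕ}
    (hγ : 2 ≤ β ^ (k + 1)) {m : Measure (ℕ → Fin 2)} (hm : IsCoinMeasure m) :
    ∃ C : ℕ, 0 < C ∧ ∀ (N : ℕ) (x r : ℝ), r ≤ ((β ^ (k + 1))⁻¹) ^ N →
      (m.map (piBeta β)) (Metric.closedBall x r) ≤ C * (2 : ENNReal)⁻¹ ^ N := by
  have hβ0 : 0 < β := by linarith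
  have hc : 0 < 1 - 1 / β := by
    rw [sub_pos, div_lt_one hβ0]; exact hβ
  set c := 1 - 1 / β with hcdef
  refine ⟨⌊3 / c⌋₊ + 1, Nat.succ_pos _, fun N x r hr => ?_⟩
  have hC : 3 / c < ((⌊3 / c⌋₊ + 1 : ℕ) : ℝ) := by
    push_cast; exact Nat.lt_floor_add_one _
  set C := ⌊3 / c⌋₊ + 1
  set δ := ((β ^ (k + 1))⁻¹) ^ N with hδ
  have hδ0 : 0 < δ := by positivity
  have hδM : (β ^ (N * (k + 1)))⁻¹ = δ := by
    rw [hδ, inv_pow, ← pow_mul, mul_comm]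
  set a := (x - 2 * δ) / c with ha
  classical
  let S : Finset (Fin (N * (k + 1)) → Fin 2) :=
    Finset.univ.filter fun w => a ≤ wordSum β N k w ∧ wordSum β N k w < a + C * δ
  have hcardS : S.card ≤ 2 ^ (N * k) * C :=
    card_words_wordSum_mem_le hγ N C a S fun w hw => (Finset.mem_filter.1 hw).2
  rw [Measure.map_apply (continuous_piBeta hβ).measurable Metric.isClosed_closedBall.measurableSet]
  have hsub : piBeta β ⁻¹' Metric.closedBall x r ⊆
      ⋃ w ∈ S, {y : ℕ → Fin 2 | ∀ j : Fin (N * (k + 1)), y j.1 = w j} := by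
    intro y hy
    rw [Set.mem_preimage, Metric.mem_closedBall, Real.dist_eq, abs_le] at hy
    have h1 := piBeta_sub_truncation_mem hβ y (N * (k + 1))
    rw [hδM, Finset.sum_range, ← hcdef] at h1
    refine Set.mem_biUnion (x := fun j : Fin (N * (k + 1)) => y j) ?_ (fun j => rfl)
    rw [Finset.mem_coe, Finset.mem_filter]
    refine ⟨Finset.mem_univ _, ?_, ?_⟩
    · rw [ha, div_le_iff₀ hc]
      unfold wordSum
      linarith [h1.1, h1.2, hy.1, hy.2]
    · have e : wordSum β N k (fun j => y j) ≤ (x + δ) / c := by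
        rw [le_div_iff₀ hc]
        unfold wordSum
        linarith [h1.1, h1.2, hy.1, hy.2]
      have e2 : (x + δ) / c = a + 3 / c * δ := by rw [ha]; field_simp; ring
      nlinarith
  calc m (piBeta β ⁻¹' Metric.closedBall x r)
      ≤ ∑ w ∈ S, m {y : ℕ → Fin 2 | ∀ j : Fin (N * (k + 1)), y j.1 = w j} :=
        (measure_mono hsub).trans (measure_biUnion_finset_le _ _)
    _ = S.card * (2 : ENNReal)⁻¹ ^ (N * (k + 1)) := by
        simp [hm.2]
    _ ≤ ((2 ^ (N * k) * C : ℕ) : ENNReal) * (2 : ENNReal)⁻¹ ^ (N * (k + 1)) := by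
        gcongr
    _ = C * (2 : ENNReal)⁻¹ ^ N := by
        have h2 : (2 : ENNReal) ^ (N * k) * (2 : ENNReal)⁻¹ ^ (N * k) = 1 := by
          rw [← mul_pow, ENNReal.mul_inv_cancel (by norm_num) (by norm_num), one_pow]
        rw [Nat.mul_succ N k, pow_add]
        push_cast
        calc _ = C * (2 : ENNReal)⁻¹ ^ N *
              ((2 : ENNReal) ^ (N * k) * (2 : ENNReal)⁻¹ ^ (N * k)) := by
              ring
          _ = _ := by rw [h2, mul_one]

theorem stmt8 (β : ℝ) (hβ : 1 < β) (k : ℕ) (hk : 1 ≤ k) (hβk : 2 ≤ β ^ k)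
    (m : Measure (ℕ → Fin 2)) (hm : IsCoinMeasure m) :
    ∀ᵐ x ∂(m.map (piBeta β)),
      Real.log 2 / (k * Real.log β) ≤
        liminf (fun r : ℝ =>
          Real.log (((m.map (piBeta β)) (Metric.closedBall x r)).toReal) / Real.log r)
          (𝓝[>] 0) := by
  have hβ0 : 0 < β := by linarith
  have hlogβ : 0 < Real.log β := Real.log_pos hβ
  have hlog2 : 0 < Real.log 2 := Real.log_pos (by norm_num)
  have hcont := continuous_piBeta hβ
  have : IsProbabilityMeasure m := hm.1
  have : IsProbabilityMeasure (m.map (piBeta β)) :=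
    Measure.isProbabilityMeasure_map hcont.measurable.aemeasurable
  obtain ⟨C, hC0, hC⟩ : ∃ C : ℕ, 0 < C ∧ ∀ (N : ℕ) (x r : ℝ), r ≤ ((β ^ k)⁻¹) ^ N →
      (m.map (piBeta β)) (Metric.closedBall x r) ≤ C * (2 : ENNReal)⁻¹ ^ N := by
    obtain ⟨k, rfl⟩ := Nat.exists_eq_add_of_le' hk
    exact hm.exists_map_closedBall_le hβ hβk
  filter_upwards [ae_map_mem_range (piBeta β) (isCompact_range hcont).isClosed.measurableSet m]
  rintro _ ⟨y, rfl⟩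
  set μ := m.map (piBeta β)
  set x := piBeta β y
  have hlow : ∀ n : ℕ, (2⁻¹ : ℝ) ^ n ≤ (μ (Metric.closedBall x ((β ^ n)⁻¹))).toReal := fun n => by
    simpa using ENNReal.toReal_mono (measure_ne_top _ _) (hm.map_closedBall_ge hβ y n)
  have hradius : Tendsto (fun n : ℕ => (β ^ n)⁻¹) atTop (𝓝[>] 0) :=
    tendsto_nhdsWithin_iff.2 ⟨tendsto_inv_atTop_zero.comp (tendsto_pow_atTop_atTop_of_one_lt hβ),
      Eventually.of_forall fun n => Set.mem_Ioi.2 (by positivity)⟩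
  have hpos : ∀ r : ℝ, 0 < r → 0 < (μ (Metric.closedBall x r)).toReal := by
    intro r hr
    obtain ⟨n, hn⟩ := (hradius.mono_right nhdsWithin_le_nhds |>.eventually (gt_mem_nhds hr)).exists
    refine lt_of_lt_of_le (by positivity) ((hlow n).trans ?_)
    exact ENNReal.toReal_mono (measure_ne_top _ _)
      (measure_mono (Metric.closedBall_subset_closedBall hn.le))
  have hcob : IsCoboundedUnder (· ≥ ·) (𝓝[>] (0 : ℝ)) fun r : ℝ =>
      Real.log ((μ (Metric.closedBall x r)).toReal) / Real.log r := by
    refine IsCoboundedUnder.of_frequently_le (a := Real.log 2 / Real.log β)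
      (hradius.frequently (Eventually.frequently ?_))
    filter_upwards [eventually_gt_atTop 0] with n hn
    have hn' : (0 : ℝ) < n := by exact_mod_cast hn
    have h1 : -(n * Real.log 2) ≤ Real.log (μ (Metric.closedBall x ((β ^ n)⁻¹))).toReal := by
      have := Real.log_le_log (by positivity) (hlow n)
      rwa [Real.log_pow, Real.log_inv, mul_neg] at this
    rw [Real.log_inv, Real.log_pow, div_neg, ← neg_div, div_le_div_iff₀ (by positivity) hlogβ]
    nlinarith
  set D := Real.log 2 / (k * Real.log β) with hD
  set K := Real.log C + Real.log 2
  have htend : Tendsto (fun r : ℝ => D + K / Real.log r) (𝓝[>] 0) (𝓝 D) := by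
    simpa using tendsto_const_nhds.add (Real.tendsto_log_nhdsGT_zero.const_div_atBot K)
  rw [← htend.liminf_eq]
  refine liminf_le_liminf ?_ htend.isBoundedUnder_ge hcob
  filter_upwards [Ioo_mem_nhdsGT (zero_lt_one' ℝ)] with r ⟨hr0, hr1⟩
  have hlr : Real.log r < 0 := Real.log_neg hr0 hr1
  have hk0 : (0 : ℝ) < k := by exact_mod_cast hk
  have hL : 0 < k * Real.log β := by positivity
  set N := ⌊-Real.log r / (k * Real.log β)⌋₊
  have hN1 : N * (k * Real.log β) ≤ -Real.log r :=
    (le_div_iff₀ hL).1 (Nat.floor_le (div_nonneg (by linarith) hL.le))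
  have hN2 : -Real.log r / (k * Real.log β) < N + 1 := Nat.lt_floor_add_one _
  have hrN : r ≤ ((β ^ k)⁻¹) ^ N := by
    rw [← Real.log_le_log_iff hr0 (by positivity), Real.log_pow, Real.log_inv, Real.log_pow]
    linarith
  have hup : (μ (Metric.closedBall x r)).toReal ≤ C * (2⁻¹ : ℝ) ^ N := by
    have := ENNReal.toReal_mono (by finiteness) (hC N x r hrN)
    simpa using this
  have hC0' : (0 : ℝ) < C := by exact_mod_cast hC0
  have hlog := Real.log_le_log (hpos r hr0) hup
  rw [Real.log_mul hC0'.ne' (by positivity), Real.log_pow, Real.log_inv] at hlog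
  rw [le_div_iff_of_neg hlr, add_mul, div_mul_cancel₀ _ hlr.ne]
  have h5 : D * -Real.log r ≤ (N + 1) * Real.log 2 := by
    rw [hD, div_mul_eq_mul_div, mul_div_assoc, mul_comm]
    gcongr
  linarith
end

section
/- For every β ∈ [√2, 1.424041], for μ_β-a.e. x ∈ ℝ, liminf_{r→0⁺} log μ_β(B̄(x,r)) / log r ≥ 0.98041. (In particular, dim(μ_β) ≥ 0.98041 for all β in this interval.) -/
open MeasureTheory Filter Topology

/-- Truncating the series of `piBeta β` after `n` digits costs at most `β⁻ⁿ`. -/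
theorem piBeta_sub_sum_mem_Icc {β : ℝ} (hβ : 1 < β) (x : ℕ → Fin 2) (n : ℕ) :
    piBeta β x - (1 - 1 / β) * ∑ k ∈ Finset.range n, ((x k : ℕ) : ℝ) / β ^ k
      ∈ Set.Icc 0 (1 / β ^ n) := by
  have hb : (0 : ℝ) < β := by linarith
  have hc : 0 < 1 - 1 / β := by
    rw [sub_pos, div_lt_one hb]; exact hβ
  have hs := summable_digits hβ x
  have hgeom := summable_geometric_of_lt_one (inv_nonneg.2 hb.le) (inv_lt_one_of_one_lt₀ hβ)
  have hsplit := hs.sum_add_tsum_nat_add n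
  have heq : piBeta β x - (1 - 1 / β) * ∑ k ∈ Finset.range n, ((x k : ℕ) : ℝ) / β ^ k
      = (1 - 1 / β) * ∑' k, ((x (k + n) : ℕ) : ℝ) / β ^ (k + n) := by
    rw [piBeta, ← hsplit]; ring
  rw [heq]
  constructor
  · exact mul_nonneg hc.le (tsum_nonneg fun k => by positivity)
  · have hle : ∑' k, ((x (k + n) : ℕ) : ℝ) / β ^ (k + n) ≤ ∑' k : ℕ, 1 / β ^ n * β⁻¹ ^ k := by
      refine Summable.tsum_le_tsum (fun k => ?_) ((summable_nat_add_iff n).2 hs)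
        (hgeom.mul_left _)
      have h : ((x (k + n) : ℕ) : ℝ) ≤ 1 := by exact_mod_cast Nat.lt_succ_iff.1 (x (k + n)).2
      have h2 : 1 / β ^ n * β⁻¹ ^ k = 1 / β ^ (k + n) := by
        rw [pow_add, inv_pow]; field_simp
      rw [h2]
      gcongr
    rw [tsum_mul_left, tsum_geometric_of_lt_one (inv_nonneg.2 hb.le)
      (inv_lt_one_of_one_lt₀ hβ)] at hle
    calc _ ≤ (1 - 1 / β) * (1 / β ^ n * (1 - β⁻¹)⁻¹) := by gcongr
      _ = 1 / β ^ n := by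
        rw [← one_div β]; field_simp
        exact div_self (sub_pos.2 hβ).ne'

theorem sum_range_two_mul {M : Type*} [AddCommMonoid M] (f : ℕ → M) (n : ℕ) :
    ∑ k ∈ Finset.range (2 * n), f k
      = ∑ j ∈ Finset.range n, f (2 * j) + ∑ j ∈ Finset.range n, f (2 * j + 1) := by
  induction n with
  | zero => simp
  | succ n ih =>
    rw [show 2 * (n + 1) = 2 * n + 1 + 1 by ring, Finset.sum_range_succ, Finset.sum_range_succ, ih,
      Finset.sum_range_succ, Finset.sum_range_succ]
    abel

/-- Separation of signed expansions with digits `-1, 0, 1` in a base `b ≥ 2`. -/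
theorem digits_eq_zero_or_le_abs_sum {b : ℝ} (hb : 2 ≤ b) (d : ℕ → ℤ) (hd : ∀ j, |d j| ≤ 1)
    (n : ℕ) :
    (∀ j < n, d j = 0) ∨ b ≤ |b ^ n * ∑ j ∈ Finset.range n, (d j : ℝ) / b ^ j| := by
  induction n with
  | zero => left; intro j hj; omega
  | succ n ih =>
    have hb0 : (0 : ℝ) < b := by linarith
    have heq : b ^ (n + 1) * ∑ j ∈ Finset.range (n + 1), (d j : ℝ) / b ^ j
        = b * (b ^ n * ∑ j ∈ Finset.range n, (d j : ℝ) / b ^ j) + b * d n := by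
      rw [Finset.sum_range_succ]; field_simp; ring
    rw [heq]
    rcases ih with h | h
    · by_cases h0 : d n = 0
      · left
        intro j hj
        rcases Nat.lt_succ_iff_lt_or_eq.1 hj with h1 | rfl
        · exact h j h1
        · exact h0
      · right
        have hz : ∑ j ∈ Finset.range n, (d j : ℝ) / b ^ j = 0 :=
          Finset.sum_eq_zero fun j hj => by simp [h j (Finset.mem_range.1 hj)]
        have h1 : (1 : ℝ) ≤ |(d n : ℝ)| := by exact_mod_cast Int.one_le_abs h0
        rw [hz, mul_zero, mul_zero, zero_add, abs_mul, abs_of_pos hb0]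
        nlinarith
    · right
      have h1 : |(d n : ℝ)| ≤ 1 := by exact_mod_cast hd n
      set T := b ^ n * ∑ j ∈ Finset.range n, (d j : ℝ) / b ^ j
      have h2 : |T| - |(d n : ℝ)| ≤ |T + d n| := by
        have := abs_sub_abs_le_abs_sub T (-(d n : ℝ))
        rwa [abs_neg, sub_neg_eq_add] at this
      rw [← mul_add, abs_mul, abs_of_pos hb0]
      nlinarith

/-- At most `7 · 2ⁿ` words of length `2n` have a partial sum in a given interval of length
`3 β⁻²ⁿ`: the odd digits are free, and they leave at most seven choices for the even ones. -/
theorem card_words_le {β : ℝ} (hβ : Real.sqrt 2 ≤ β) (n : ℕ) (x : ℝ)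
    (W : Finset (Fin (2 * n) → Fin 2)) (e : (Fin (2 * n) → Fin 2) → ℕ → Fin 2)
    (he : ∀ w (j : Fin (2 * n)), e w j = w j)
    (hW : ∀ w ∈ W, (1 - 1 / β) * ∑ k ∈ Finset.range (2 * n), ((e w k : ℕ) : ℝ) / β ^ k
      ∈ Set.Icc (x - 2 / β ^ (2 * n)) (x + 1 / β ^ (2 * n))) :
    W.card ≤ 7 * 2 ^ n := by
  have hs2 : (1.414 : ℝ) ≤ Real.sqrt 2 := Real.le_sqrt_of_sq_le (by norm_num)
  have hβ1 : (1.414 : ℝ) ≤ β := hs2.trans hβ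
  have hb0 : (0 : ℝ) < β := by linarith
  have hb2 : (2 : ℝ) ≤ β ^ 2 := by
    have := Real.sq_sqrt (show (0 : ℝ) ≤ 2 by norm_num)
    nlinarith [Real.sqrt_nonneg 2]
  have hc : (0 : ℝ) < β ^ 2 - β := by nlinarith
  have hβn : (0 : ℝ) < β ^ (2 * n) := by positivity
  set V : (Fin (2 * n) → Fin 2) → ℝ := fun w =>
    (1 - 1 / β) * ∑ k ∈ Finset.range (2 * n), ((e w k : ℕ) : ℝ) / β ^ k with hV
  -- the position of the partial sum inside the interval, in units of the separation
  set P : (Fin (2 * n) → Fin 2) → ℝ := fun w =>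
    (V w - (x - 2 / β ^ (2 * n))) * β ^ (2 * n) / (β ^ 2 - β) with hP
  have hP0 : ∀ w ∈ W, 0 ≤ P w := fun w hw => by
    have := (hW w hw).1
    exact div_nonneg (mul_nonneg (sub_nonneg.2 this) hβn.le) hc.le
  have hP7 : ∀ w ∈ W, P w < 7 := fun w hw => by
    have h1 : V w ≤ x + 1 / β ^ (2 * n) := (hW w hw).2
    have h2 : (V w - (x - 2 / β ^ (2 * n))) * β ^ (2 * n) ≤ 3 := by
      calc _ ≤ (3 / β ^ (2 * n)) * β ^ (2 * n) := by
            gcongr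
            have : 3 / β ^ (2 * n) = 2 / β ^ (2 * n) + 1 / β ^ (2 * n) := by ring
            linarith
        _ = 3 := by field_simp
    simp only [hP]
    rw [div_lt_iff₀ hc]
    nlinarith
  have hcard : (Finset.univ ×ˢ Finset.range 7 : Finset ((Fin n → Fin 2) × ℕ)).card = 7 * 2 ^ n := by
    rw [Finset.card_product]; simp [mul_comm]
  rw [← hcard]
  refine Finset.card_le_card_of_injOn
    (fun w => (fun j : Fin n => e w (2 * j + 1), ⌊P w⌋₊)) (fun w hw => ?_) ?_
  · simp only [Finset.coe_product, Finset.coe_univ, Finset.coe_range, Set.mem_prod, Set.mem_univ,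
      true_and, Set.mem_Iio]
    exact (Nat.floor_lt (hP0 w hw)).2 (by exact_mod_cast hP7 w hw)
  · intro w hw w' hw' hww
    obtain ⟨hodd, hfl⟩ := Prod.mk.inj hww
    have hodd' : ∀ j < n, e w (2 * j + 1) = e w' (2 * j + 1) := fun j hj =>
      congrFun hodd ⟨j, hj⟩
    set d : ℕ → ℤ := fun j => ((e w (2 * j) : ℕ) : ℤ) - ((e w' (2 * j) : ℕ) : ℤ) with hd
    have hd1 : ∀ j, |d j| ≤ 1 := fun j => by
      have h1 := (e w (2 * j)).2
      have h2 := (e w' (2 * j)).2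
      simp only [hd]
      rw [abs_le]; omega
    have hdiff : V w - V w' = (1 - 1 / β) * ∑ j ∈ Finset.range n, (d j : ℝ) / (β ^ 2) ^ j := by
      simp only [hV]
      rw [← mul_sub, sum_range_two_mul, sum_range_two_mul]
      have ho : ∑ j ∈ Finset.range n, ((e w (2 * j + 1) : ℕ) : ℝ) / β ^ (2 * j + 1)
          = ∑ j ∈ Finset.range n, ((e w' (2 * j + 1) : ℕ) : ℝ) / β ^ (2 * j + 1) :=
        Finset.sum_congr rfl fun j hj => by rw [hodd' j (Finset.mem_range.1 hj)]
      rw [ho, add_sub_add_right_eq_sub, ← Finset.sum_sub_distrib]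
      congr 1
      refine Finset.sum_congr rfl fun j _ => ?_
      simp only [hd]
      push_cast
      rw [← pow_mul, sub_div]
    have hclose : |P w - P w'| < 1 := by
      have a1 := Nat.floor_le (hP0 w hw)
      have a2 := Nat.lt_floor_add_one (P w)
      have a3 := Nat.floor_le (hP0 w' hw')
      have a4 := Nat.lt_floor_add_one (P w')
      have hfl' : (⌊P w⌋₊ : ℝ) = ⌊P w'⌋₊ := by exact_mod_cast hfl
      rw [abs_lt]; constructor <;> linarith
    have hPd : P w - P w'
        = ((β ^ 2) ^ n * ∑ j ∈ Finset.range n, (d j : ℝ) / (β ^ 2) ^ j) / β ^ 2 := by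
      have h1 : P w - P w' = (V w - V w') * β ^ (2 * n) / (β ^ 2 - β) := by
        simp only [hP]; ring
      have hc' : β - 1 ≠ 0 := by intro h; linarith
      rw [h1, hdiff, ← pow_mul β 2 n, show β ^ 2 - β = β * (β - 1) by ring]
      field_simp
    rcases digits_eq_zero_or_le_abs_sum hb2 d hd1 n with h | h
    · have heven : ∀ j < n, e w (2 * j) = e w' (2 * j) := fun j hj => by
        have := h j hj
        simp only [hd] at this
        exact Fin.ext (by omega)
      funext i
      rw [← he w i, ← he w' i]
      rcases Nat.even_or_odd' (i : ℕ) with ⟨j, hj | hj⟩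
      · rw [hj]; exact heven j (by have := i.2; omega)
      · rw [hj]; exact hodd' j (by have := i.2; omega)
    · exfalso
      rw [hPd, abs_div, abs_of_pos (by positivity : (0 : ℝ) < β ^ 2),
        div_lt_one (by positivity)] at hclose
      linarith

/-- The Frostman-type upper bound `μ_β(B̄(x, β⁻²ⁿ)) ≤ 7 · 2⁻ⁿ`. -/
theorem measure_closedBall_le {β : ℝ} (hβ : Real.sqrt 2 ≤ β) {m : Measure (ℕ → Fin 2)}
    (hm : IsCoinMeasure m) (n : ℕ) (x : ℝ) {r : ℝ} (hr : r ≤ 1 / β ^ (2 * n)) :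
    (m.map (piBeta β)) (Metric.closedBall x r) ≤ 7 * (2 : ENNReal)⁻¹ ^ n := by
  have hs2 : (1.414 : ℝ) ≤ Real.sqrt 2 := Real.le_sqrt_of_sq_le (by norm_num)
  have hβ1 : 1 < β := by linarith
  rw [Measure.map_apply (continuous_piBeta hβ1).measurable Metric.isClosed_closedBall.measurableSet]
  classical
  set e : (Fin (2 * n) → Fin 2) → ℕ → Fin 2 := fun w k => if h : k < 2 * n then w ⟨k, h⟩ else 0
    with he_def
  have he : ∀ w (j : Fin (2 * n)), e w j = w j := fun w j => by simp [he_def]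
  set W : Finset (Fin (2 * n) → Fin 2) := Finset.univ.filter fun w =>
    (1 - 1 / β) * ∑ k ∈ Finset.range (2 * n), ((e w k : ℕ) : ℝ) / β ^ k
      ∈ Set.Icc (x - 2 / β ^ (2 * n)) (x + 1 / β ^ (2 * n)) with hW_def
  have hcard := card_words_le hβ n x W e he fun w hw => (Finset.mem_filter.1 hw).2
  have hsub : piBeta β ⁻¹' Metric.closedBall x r
      ⊆ ⋃ w ∈ W, {y : ℕ → Fin 2 | ∀ j : Fin (2 * n), y j.1 = w j} := by
    intro y hy
    rw [Set.mem_preimage, Metric.mem_closedBall, Real.dist_eq, abs_le] at hy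
    simp only [Set.mem_iUnion]
    refine ⟨fun j => y j, ?_, fun j => rfl⟩
    have hsum : ∑ k ∈ Finset.range (2 * n), ((e (fun j => y j) k : ℕ) : ℝ) / β ^ k
        = ∑ k ∈ Finset.range (2 * n), ((y k : ℕ) : ℝ) / β ^ k :=
      Finset.sum_congr rfl fun k hk => by
        have hk' := Finset.mem_range.1 hk
        simp only [he_def, dif_pos hk']
    have ht := piBeta_sub_sum_mem_Icc hβ1 y (2 * n)
    rw [hW_def, Finset.mem_filter, hsum]
    have h2 : 2 / β ^ (2 * n) = 1 / β ^ (2 * n) + 1 / β ^ (2 * n) := by ring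
    refine ⟨Finset.mem_univ _, ?_, ?_⟩
    · have := ht.2; rw [h2]; linarith [hy.1]
    · have := ht.1; linarith [hy.2]
  calc m (piBeta β ⁻¹' Metric.closedBall x r)
      ≤ ∑ w ∈ W, m {y : ℕ → Fin 2 | ∀ j : Fin (2 * n), y j.1 = w j} :=
        (measure_mono hsub).trans (measure_biUnion_finset_le _ _)
    _ = W.card * (2 : ENNReal)⁻¹ ^ (2 * n) := by
        rw [Finset.sum_congr rfl fun w _ => hm.2 (2 * n) w, Finset.sum_const, nsmul_eq_mul]
    _ ≤ ((7 * 2 ^ n : ℕ) : ENNReal) * (2 : ENNReal)⁻¹ ^ (2 * n) := by gcongr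
    _ = 7 * (2 : ENNReal)⁻¹ ^ n := by
        push_cast
        rw [two_mul, pow_add, mul_assoc, ← mul_assoc (2 ^ n), ← mul_pow,
          ENNReal.mul_inv_cancel (by norm_num) (by norm_num), one_pow, one_mul]

/-- Around a coded point, `μ_β(B̄(x, β⁻ⁿ)) ≥ 2⁻ⁿ`. -/
theorem le_measure_closedBall {β : ℝ} (hβ : 1 < β) {m : Measure (ℕ → Fin 2)}
    (hm : IsCoinMeasure m) (n : ℕ) (y : ℕ → Fin 2) {r : ℝ} (hr : 1 / β ^ n ≤ r) :
    (2 : ENNReal)⁻¹ ^ n ≤ (m.map (piBeta β)) (Metric.closedBall (piBeta β y) r) := by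
  rw [Measure.map_apply (continuous_piBeta hβ).measurable Metric.isClosed_closedBall.measurableSet,
    ← hm.2 n fun j => y j]
  refine measure_mono fun z hz => ?_
  have hsum : ∑ k ∈ Finset.range n, ((z k : ℕ) : ℝ) / β ^ k
      = ∑ k ∈ Finset.range n, ((y k : ℕ) : ℝ) / β ^ k :=
    Finset.sum_congr rfl fun k hk => by rw [hz ⟨k, Finset.mem_range.1 hk⟩]
  have h1 := piBeta_sub_sum_mem_Icc hβ y n
  have h2 := piBeta_sub_sum_mem_Icc hβ z n
  rw [hsum] at h2
  rw [Set.mem_preimage, Metric.mem_closedBall, Real.dist_eq, abs_le]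
  constructor <;> linarith [h1.1, h1.2, h2.1, h2.2]

/-- The similarity dimension `log 2 / log β²` exceeds `0.98041` for `β ≤ 1.424041`. -/
theorem log_sq_lt {β : ℝ} (hβ0 : 0 < β) (hβ : β ≤ 1.424041) :
    0.98041 * Real.log (β ^ 2) < Real.log 2 := by
  have h1 : β ^ 2 ≤ 2 * Real.exp 0.01385005 := by
    have := Real.sum_le_exp_of_nonneg (show (0 : ℝ) ≤ 0.01385005 by norm_num) 5
    norm_num [Finset.sum_range_succ, Nat.factorial] at this
    norm_num
    nlinarith
  have h2 : Real.log (β ^ 2) ≤ Real.log 2 + 0.01385005 := by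
    have := Real.log_le_log (by positivity) h1
    rwa [Real.log_mul (by norm_num) (Real.exp_pos _).ne', Real.log_exp] at this
  linarith [Real.log_two_gt_d9]

theorem stmt9 (β : ℝ) (hβ1 : Real.sqrt 2 ≤ β) (hβ2 : β ≤ 1.424041)
    (m : Measure (ℕ → Fin 2)) (hm : IsCoinMeasure m) :
    ∀ᵐ x ∂(m.map (piBeta β)),
      (0.98041 : ℝ) ≤
        liminf (fun r : ℝ =>
          Real.log (((m.map (piBeta β)) (Metric.closedBall x r)).toReal) / Real.log r)
          (𝓝[>] 0) := by
  have hs2 : (1.414 : ℝ) ≤ Real.sqrt 2 := Real.le_sqrt_of_sq_le (by norm_num)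
  have hβ : 1 < β := by linarith
  have hβ0 : 0 < β := by linarith
  have hcont := continuous_piBeta hβ
  have := hm.1
  have : IsProbabilityMeasure (m.map (piBeta β)) :=
    Measure.isProbabilityMeasure_map hcont.measurable.aemeasurable
  have hrange : ∀ᵐ x ∂(m.map (piBeta β)), x ∈ Set.range (piBeta β) :=
    (ae_map_iff hcont.measurable.aemeasurable
      (isCompact_range hcont).isClosed.measurableSet).2 (Eventually.of_forall fun y => ⟨y, rfl⟩)
  filter_upwards [hrange] with x hx
  obtain ⟨y, rfl⟩ := hx
  have hlow : ∀ (n : ℕ) (r : ℝ), 1 / β ^ n ≤ r →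
      (2 : ℝ)⁻¹ ^ n ≤ ((m.map (piBeta β)) (Metric.closedBall (piBeta β y) r)).toReal := by
    intro n r hr
    have h := ENNReal.toReal_mono (measure_ne_top _ _) (le_measure_closedBall hβ hm n y hr)
    simpa using h
  have hlogβ : 0 < Real.log β := Real.log_pos hβ
  refine le_liminf_of_le ?_ ?_
  · -- the quotient is at most `log 2 / log β` along `r = β⁻ⁿ`
    refine Filter.IsCoboundedUnder.of_frequently_le (a := Real.log 2 / Real.log β) ?_
    have htend : Tendsto (fun n : ℕ => 1 / β ^ (n + 1)) atTop (𝓝[>] 0) := by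
      refine tendsto_nhdsWithin_iff.2 ⟨?_, Eventually.of_forall fun n => ?_⟩
      · have := (tendsto_pow_atTop_nhds_zero_of_lt_one (inv_nonneg.2 hβ0.le)
          (inv_lt_one_of_one_lt₀ hβ)).comp (tendsto_add_atTop_nat 1)
        refine this.congr fun n => ?_
        simp
      · exact Set.mem_Ioi.2 (by positivity)
    refine htend.frequently (Eventually.of_forall fun n => ?_).frequently
    have h1 := Real.log_le_log (by positivity) (hlow (n + 1) _ le_rfl)
    rw [Real.log_pow, Real.log_inv] at h1
    have h2 : Real.log (1 / β ^ (n + 1)) = -(((n + 1 : ℕ) : ℝ) * Real.log β) := by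
      rw [one_div, Real.log_inv, Real.log_pow]
    have hn : (0 : ℝ) < ((n + 1 : ℕ) : ℝ) := by positivity
    rw [h2, div_neg, ← neg_div, div_le_div_iff₀ (mul_pos hn hlogβ) hlogβ]
    nlinarith
  · have hδ := log_sq_lt hβ0 hβ2
    have hb2 : 1 < β ^ 2 := by nlinarith
    have hL : 0 < Real.log (β ^ 2) := Real.log_pos hb2
    have hpos : ∀ᶠ r : ℝ in 𝓝[>] 0, 0 < r := eventually_mem_nhdsWithin
    have hlog := Real.tendsto_log_nhdsGT_zero.eventually
      (eventually_le_atBot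
        (-(Real.log 14 * Real.log (β ^ 2) / (Real.log 2 - 0.98041 * Real.log (β ^ 2)))))
    have hlt1 : ∀ᶠ r : ℝ in 𝓝[>] 0, r < 1 :=
      (eventually_lt_nhds one_pos).filter_mono nhdsWithin_le_nhds
    filter_upwards [hpos, hlog, hlt1] with r hr0 hr hr1
    have hlr : Real.log r < 0 := Real.log_neg hr0 hr1
    obtain ⟨n, hn1, hn2⟩ := exists_nat_pow_near (one_le_inv_iff₀.2 ⟨hr0, hr1.le⟩) hb2
    have hmass : 0 < ((m.map (piBeta β)) (Metric.closedBall (piBeta β y) r)).toReal := by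
      refine lt_of_lt_of_le (by positivity) (hlow (2 * (n + 1)) r ?_)
      rw [pow_mul, one_div]
      exact (inv_lt_of_inv_lt₀ hr0 hn2).le
    have hup : ((m.map (piBeta β)) (Metric.closedBall (piBeta β y) r)).toReal
        ≤ 14 * (2 : ℝ)⁻¹ ^ (n + 1) := by
      have h := ENNReal.toReal_mono (ENNReal.mul_ne_top (by norm_num)
        (ENNReal.pow_ne_top (by norm_num)))
        (measure_closedBall_le hβ1 hm n (piBeta β y) (r := r) (by
          rw [pow_mul, one_div]; exact le_inv_of_le_inv₀ (by positivity) hn1))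
      simp only [ENNReal.toReal_mul, ENNReal.toReal_pow, ENNReal.toReal_inv,
        ENNReal.toReal_ofNat] at h
      rw [pow_succ]
      linarith
    have h1 := Real.log_le_log hmass hup
    rw [Real.log_mul (by norm_num) (by positivity), Real.log_pow, Real.log_inv] at h1
    have h2 : -Real.log r ≤ ((n + 1 : ℕ) : ℝ) * Real.log (β ^ 2) := by
      have := Real.log_le_log (inv_pos.2 hr0) hn2.le
      rwa [Real.log_inv, Real.log_pow] at this
    have h3 : Real.log 14 * Real.log (β ^ 2)
        ≤ -Real.log r * (Real.log 2 - 0.98041 * Real.log (β ^ 2)) := by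
      rw [← div_le_iff₀ (by linarith)]; linarith
    rw [le_div_iff_of_neg hlr]
    have hl2 : 0 < Real.log 2 := Real.log_pos (by norm_num)
    have h4 : -Real.log r * Real.log 2
        ≤ ((n + 1 : ℕ) : ℝ) * Real.log (β ^ 2) * Real.log 2 := by gcongr
    refine le_of_mul_le_mul_right ?_ hL
    have h5 := mul_le_mul_of_nonneg_right h1 hL.le
    linarith
end

section
/- Let β ∈ [√2, 2) and δ > 0, and set ε = (δ/β)(1 + 3/β⁴) if β ≤ 1.5 and ε = (δ/β)(1 + 2/β³) if β > 1.5. Then for every β' with β ≤ β' ≤ β + δ and β' ≤ 2, every interval [a,b] ⊆ [0,1], and each i ∈ {1,2}: μ_{β'}( S_{i,β'}^{-1}[a,b] ) ≤ μ_β( S_{i,β}^{-1}[a − ε, b + ε] ). -/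
open MeasureTheory Filter Topology

lemma summable_digits_mul_pow (x : ℕ → Fin 2) {r : ℝ} (h0 : 0 ≤ r) (h1 : r < 1) :
    Summable fun n : ℕ => ((x n : ℕ) : ℝ) * r ^ n := by
  refine Summable.of_nonneg_of_le (fun n => by positivity) (fun n => ?_)
    (summable_geometric_of_lt_one h0 h1)
  have h : ((x n : ℕ) : ℝ) ≤ 1 := by exact_mod_cast Nat.le_of_lt_succ (x n).isLt
  exact mul_le_of_le_one_left (by positivity) h

lemma piBeta_eq (β : ℝ) (x : ℕ → Fin 2) :
    piBeta β x = (1 - β⁻¹) * ∑' n : ℕ, ((x n : ℕ) : ℝ) * β⁻¹ ^ n := by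
  simp only [piBeta, div_eq_mul_inv, inv_pow, one_mul]

lemma measurable_piBeta {β : ℝ} (hβ : 1 < β) : Measurable (piBeta β) := by
  have h : piBeta β = fun x => (1 - β⁻¹) * ∑' n : ℕ, ((x n : ℕ) : ℝ) * β⁻¹ ^ n :=
    funext (piBeta_eq β)
  rw [h]
  refine Measurable.const_mul ?_ _
  refine measurable_of_tendsto_metrizable
    (f := fun N (x : ℕ → Fin 2) => ∑ n ∈ Finset.range N, ((x n : ℕ) : ℝ) * β⁻¹ ^ n)
    (fun N => ?_) ?_
  · refine Finset.measurable_sum _ fun n _ => Measurable.mul_const ?_ _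
    exact (measurable_of_countable (fun i : Fin 2 => ((i : ℕ) : ℝ))).comp (measurable_pi_apply n)
  · rw [tendsto_pi_nhds]
    intro x
    exact (summable_digits_mul_pow x (by positivity)
      (inv_lt_one_of_one_lt₀ hβ)).hasSum.tendsto_sum_nat

/-- `r ↦ rⁿ (1 - r)` is increasing on `[0, 3/4]` for `n ≥ 3`. -/
lemma pow_mul_one_sub_mono (n : ℕ) {r s : ℝ} (hs : 0 ≤ s) (hsr : s ≤ r) (hr : r ≤ 3 / 4) :
    s ^ (n + 3) * (1 - s) ≤ r ^ (n + 3) * (1 - r) := by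
  have h3 : s ^ 3 * (1 - s) ≤ r ^ 3 * (1 - r) := by
    have h : 0 ≤ (r - s) * ((r ^ 2 + r * s + s ^ 2) - (r + s) * (r ^ 2 + s ^ 2)) := by
      refine mul_nonneg (by linarith) ?_
      nlinarith [mul_nonneg (by linarith : 0 ≤ 3 / 4 - r) (sq_nonneg r),
        mul_nonneg (by linarith : 0 ≤ 3 / 4 - r) (sq_nonneg s),
        mul_nonneg (by linarith : 0 ≤ 3 / 4 - s) (sq_nonneg r),
        mul_nonneg (by linarith : 0 ≤ 3 / 4 - s) (sq_nonneg s), sq_nonneg (r - s),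
        mul_nonneg hs (by linarith : 0 ≤ r - s)]
    linarith
  have hp : s ^ n ≤ r ^ n := pow_le_pow_left₀ hs hsr n
  have h0 : 0 ≤ s ^ 3 * (1 - s) := mul_nonneg (by positivity) (by linarith)
  calc s ^ (n + 3) * (1 - s) = s ^ n * (s ^ 3 * (1 - s)) := by ring
    _ ≤ r ^ n * (r ^ 3 * (1 - r)) := mul_le_mul hp h3 h0 (pow_nonneg (hs.trans hsr) n)
    _ = r ^ (n + 3) * (1 - r) := by ring

/-- The digits from index `2` on contribute monotonically, and at most as if all were `1`. -/
lemma digits_tail_bounds (x : ℕ → Fin 2) {r s : ℝ} (hs : 0 ≤ s) (hsr : s ≤ r)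
    (hr : r ≤ 3 / 4) :
    0 ≤ r ^ 3 * (1 - r) * (∑' n : ℕ, ((x n : ℕ) : ℝ) * r ^ n) -
        s ^ 3 * (1 - s) * (∑' n : ℕ, ((x n : ℕ) : ℝ) * s ^ n) ∧
      r ^ 3 * (1 - r) * (∑' n : ℕ, ((x n : ℕ) : ℝ) * r ^ n) -
        s ^ 3 * (1 - s) * (∑' n : ℕ, ((x n : ℕ) : ℝ) * s ^ n) ≤ r ^ 3 - s ^ 3 := by
  have hr0 : 0 ≤ r := hs.trans hsr
  have hr1 : r < 1 := by linarith
  have hs1 : s < 1 := by linarith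
  have hD := (((summable_digits_mul_pow x hr0 hr1).hasSum.mul_left (r ^ 3 * (1 - r))).sub
    ((summable_digits_mul_pow x hs hs1).hasSum.mul_left (s ^ 3 * (1 - s))))
  have hG := (((hasSum_geometric_of_lt_one hr0 hr1).mul_left (r ^ 3 * (1 - r))).sub
    ((hasSum_geometric_of_lt_one hs hs1).mul_left (s ^ 3 * (1 - s))))
  rw [mul_assoc, mul_inv_cancel₀ (by linarith), mul_assoc, mul_inv_cancel₀ (by linarith),
    mul_one, mul_one] at hG
  have hterm (n : ℕ) : r ^ 3 * (1 - r) * (((x n : ℕ) : ℝ) * r ^ n) -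
      s ^ 3 * (1 - s) * (((x n : ℕ) : ℝ) * s ^ n) =
      ((x n : ℕ) : ℝ) * (r ^ (n + 3) * (1 - r) - s ^ (n + 3) * (1 - s)) := by ring
  refine ⟨hD.nonneg fun n => ?_, hasSum_le (fun n => ?_) hD hG⟩
  · rw [hterm]
    exact mul_nonneg (by positivity) (sub_nonneg.2 (pow_mul_one_sub_mono n hs hsr hr))
  · rw [hterm]
    have h : ((x n : ℕ) : ℝ) ≤ 1 := by exact_mod_cast Nat.le_of_lt_succ (x n).isLt
    refine (mul_le_of_le_one_left (sub_nonneg.2 (pow_mul_one_sub_mono n hs hsr hr)) h).trans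
      (le_of_eq (by ring))

lemma tsum_digits_eq (x : ℕ → Fin 2) {r : ℝ} (h0 : 0 ≤ r) (h1 : r < 1) :
    ∑' n : ℕ, ((x n : ℕ) : ℝ) * r ^ n =
      ((x 0 : ℕ) : ℝ) + ((x 1 : ℕ) : ℝ) * r +
        r ^ 2 * ∑' n : ℕ, ((x (n + 2) : ℕ) : ℝ) * r ^ n := by
  rw [← (summable_digits_mul_pow x h0 h1).sum_add_tsum_nat_add 2, ← tsum_mul_left]
  simp only [Finset.sum_range_succ, Finset.sum_range_zero, pow_zero, pow_one, mul_one, zero_add]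
  congr 1
  exact tsum_congr fun n => by ring

/-- Distance between the codings, at inverse bases `s ≤ r`, of the sequence `x` preceded by one
fixed digit. -/
lemma digits_sum_dist (x : ℕ → Fin 2) {r s E : ℝ} (hs : 1 / 2 ≤ s) (hsr : s ≤ r)
    (hr : r ≤ 3 / 4) (hE2 : r ^ 2 - s ^ 2 ≤ E) (hE3 : r ^ 3 - s ^ 3 ≤ E) :
    |r * ((1 - r) * ∑' n : ℕ, ((x n : ℕ) : ℝ) * r ^ n) -
        s * ((1 - s) * ∑' n : ℕ, ((x n : ℕ) : ℝ) * s ^ n)| ≤ E ∧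
      |(r * ((1 - r) * ∑' n : ℕ, ((x n : ℕ) : ℝ) * r ^ n) - r) -
        (s * ((1 - s) * ∑' n : ℕ, ((x n : ℕ) : ℝ) * s ^ n) - s)| ≤ E := by
  obtain ⟨h1, h2⟩ := digits_tail_bounds (fun n => x (n + 2)) (by linarith) hsr hr
  rw [tsum_digits_eq x (by linarith : 0 ≤ r) (by linarith),
    tsum_digits_eq x (by linarith : 0 ≤ s) (by linarith)]
  set A := ∑' n : ℕ, ((x (n + 2) : ℕ) : ℝ) * r ^ n
  set B := ∑' n : ℕ, ((x (n + 2) : ℕ) : ℝ) * s ^ n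
  have hw0 : r - s - (r ^ 2 - s ^ 2) ≤ 0 := by nlinarith
  have key (i : Fin 2) : (i : ℕ) = 0 ∨ (i : ℕ) = 1 := by omega
  rcases key (x 0) with e0 | e0 <;> rcases key (x 1) with e1 | e1 <;>
    simp only [e0, e1, Nat.cast_zero, Nat.cast_one, abs_le] <;>
    refine ⟨⟨?_, ?_⟩, ?_, ?_⟩ <;> linarith

lemma inv_pow_sub_le {β β' δ ε : ℝ} (hβ1 : Real.sqrt 2 ≤ β) (hβ2 : β < 2) (hδ : 0 < δ)
    (hε : ε = if β ≤ 1.5 then (δ / β) * (1 + 3 / β ^ 4) else (δ / β) * (1 + 2 / β ^ 3))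
    (h1 : β ≤ β') (h2 : β' ≤ β + δ) :
    β⁻¹ ^ 2 - β'⁻¹ ^ 2 ≤ ε ∧ β⁻¹ ^ 3 - β'⁻¹ ^ 3 ≤ ε := by
  have hsq : 2 ≤ β ^ 2 := (Real.sqrt_le_left (by linarith [Real.sqrt_nonneg 2])).1 hβ1
  have hβ : 1.414 ≤ β := by nlinarith [Real.sqrt_nonneg 2]
  have hdiff : β⁻¹ - β'⁻¹ = β⁻¹ * β'⁻¹ * (β' - β) := by
    have : 0 < β' := by linarith
    field_simp
  set r := β⁻¹ with hrdef
  set s := β'⁻¹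
  have hr0 : 0 < r := by positivity
  have hs0 : 0 < s := inv_pos.2 (by linarith)
  have hsr : s ≤ r := inv_anti₀ (by linarith) h1
  have hr2 : r ^ 2 ≤ 1 / 2 := by
    rw [hrdef, inv_pow, inv_le_comm₀ (by positivity) (by norm_num)]; linarith
  have hrl : 1 / 2 ≤ r := by
    rw [hrdef, le_inv_comm₀ (by norm_num) (by positivity)]; linarith
  have hru : r ≤ 0.708 := by nlinarith
  have hεr : δ * r * (1 + 3 / 16) ≤ ε := by
    rw [hε]
    split_ifs
    · have : 3 / β ^ 4 = 3 * (r ^ 2) ^ 2 := by rw [hrdef]; field_simp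
      rw [this, div_eq_mul_inv δ β, ← hrdef]
      have : 1 / 4 ≤ r ^ 2 := by nlinarith
      gcongr
      nlinarith
    · have : 2 / β ^ 3 = 2 * r ^ 3 := by rw [hrdef]; field_simp
      rw [this, div_eq_mul_inv δ β, ← hrdef]
      have : (1 / 2) ^ 3 ≤ r ^ 3 := by gcongr
      gcongr
      linarith
  have hd : r - s ≤ r * r * δ := by
    rw [hdiff]
    gcongr
    linarith
  have hδr : 0 < δ * r := by positivity
  constructor
  · calc r ^ 2 - s ^ 2 = (r - s) * (r + s) := by ring
      _ ≤ (r * r * δ) * (r + r) := by gcongr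
      _ = δ * r * (2 * r ^ 2) := by ring
      _ ≤ δ * r * (1 + 3 / 16) := by gcongr; linarith
      _ ≤ ε := hεr
  · calc r ^ 3 - s ^ 3 = (r - s) * (r ^ 2 + r * s + s ^ 2) := by ring
      _ ≤ (r * r * δ) * (r ^ 2 + r * r + r ^ 2) := by gcongr
      _ = δ * r * (3 * (r ^ 2 * r)) := by ring
      _ ≤ δ * r * (1 + 3 / 16) := by gcongr; nlinarith
      _ ≤ ε := hεr

theorem stmt11 (β δ : ℝ) (hβ1 : Real.sqrt 2 ≤ β) (hβ2 : β < 2) (hδ : 0 < δ)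
    (ε : ℝ)
    (hε : ε = if β ≤ 1.5 then (δ / β) * (1 + 3 / β ^ 4) else (δ / β) * (1 + 2 / β ^ 3))
    (m : Measure (ℕ → Fin 2)) (hm : IsCoinMeasure m) :
    ∀ β' : ℝ, β ≤ β' → β' ≤ β + δ → β' ≤ 2 →
      ∀ a b : ℝ, 0 ≤ a → a ≤ b → b ≤ 1 →
        ((m.map (piBeta β')) ((fun x : ℝ => x / β') ⁻¹' Set.Icc a b) ≤
            (m.map (piBeta β)) ((fun x : ℝ => x / β) ⁻¹' Set.Icc (a - ε) (b + ε))) ∧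
        ((m.map (piBeta β')) ((fun x : ℝ => x / β' + 1 - 1 / β') ⁻¹' Set.Icc a b) ≤
            (m.map (piBeta β))
              ((fun x : ℝ => x / β + 1 - 1 / β) ⁻¹' Set.Icc (a - ε) (b + ε))) := by
  intro β' h1 h2 h3 a b _ _ _
  have hsq : 2 ≤ β ^ 2 := (Real.sqrt_le_left (by linarith [Real.sqrt_nonneg 2])).1 hβ1
  have hβ : 4 / 3 ≤ β := by nlinarith [Real.sqrt_nonneg 2]
  obtain ⟨hE2, hE3⟩ := inv_pow_sub_le hβ1 hβ2 hδ hε h1 h2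
  have hsl : 1 / 2 ≤ β'⁻¹ := by
    rw [le_inv_comm₀ (by norm_num) (by linarith)]; linarith
  have hsr : β'⁻¹ ≤ β⁻¹ := inv_anti₀ (by linarith) h1
  have hru : β⁻¹ ≤ 3 / 4 := by
    rw [inv_le_comm₀ (by linarith) (by norm_num)]; linarith
  have hm' : Measurable (piBeta β') := measurable_piBeta (by linarith)
  have hm0 : Measurable (piBeta β) := measurable_piBeta (by linarith)
  have hdist (x : ℕ → Fin 2) := digits_sum_dist x hsl hsr hru hE2 hE3
  simp only [← piBeta_eq, abs_le] at hdist
  constructor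
  · rw [Measure.map_apply hm' (measurableSet_Icc.preimage (by fun_prop)),
      Measure.map_apply hm0 (measurableSet_Icc.preimage (by fun_prop))]
    refine measure_mono fun x hx => ?_
    obtain ⟨⟨d1, d2⟩, -⟩ := hdist x
    simp only [Set.mem_preimage, Set.mem_Icc, div_eq_mul_inv] at hx ⊢
    constructor <;> linarith [hx.1, hx.2]
  · rw [Measure.map_apply hm' (measurableSet_Icc.preimage (by fun_prop)),
      Measure.map_apply hm0 (measurableSet_Icc.preimage (by fun_prop))]
    refine measure_mono fun x hx => ?_
    obtain ⟨-, d1, d2⟩ := hdist x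
    simp only [Set.mem_preimage, Set.mem_Icc, div_eq_mul_inv, one_mul] at hx ⊢
    constructor <;> linarith [hx.1, hx.2]
end

section
/- Let (i_n)_{n≥1} be a sequence with each i_n ∈ {0,1}, and define g : (0,1) → ℝ by g(x) = (1−x) ∑_{n=1}^∞ i_n x^{n−1}. Then for every integer k ≥ 2 and every x ∈ [1 − 1/k, 1 − 1/(k+1)), g is differentiable at x and |g'(x)| ≤ k x^{k−1}. -/
open Filter Topology

theorem hasSum_nat_mul_pow_pred {x : ℝ} (h0 : 0 < x) (h1 : x < 1) :
    HasSum (fun n : ℕ => (n : ℝ) * x ^ (n - 1)) (1 / (1 - x) ^ 2) := by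
  have h := (hasSum_coe_mul_geometric_of_norm_lt_one
    (show ‖x‖ < 1 by rwa [Real.norm_of_nonneg h0.le])).mul_left x⁻¹
  rw [show x⁻¹ * (x / (1 - x) ^ 2) = 1 / (1 - x) ^ 2 by field_simp] at h
  refine (congrArg (HasSum · _) (funext fun n => ?_)).mp h
  cases n with
  | zero => simp
  | succ n => simp only [Nat.add_sub_cancel, pow_succ]; field_simp

theorem hasDerivAt_tsum_mul_pow {a : ℕ → ℝ} (ha : ∀ n, |a n| ≤ 1) {x : ℝ}
    (h0 : 0 < x) (h1 : x < 1) :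
    HasDerivAt (fun y => ∑' n, a n * y ^ n) (∑' n, a n * (n * x ^ (n - 1))) x := by
  obtain ⟨r, hxr, hr1⟩ := exists_between h1
  refine hasDerivAt_tsum_of_isPreconnected (t := Set.Ioo 0 r) (y₀ := x)
    (g := fun n y => a n * y ^ n) (g' := fun n y => a n * (n * y ^ (n - 1)))
    (hasSum_nat_mul_pow_pred (h0.trans hxr) hr1).summable isOpen_Ioo isPreconnected_Ioo
    (fun n y _ => (hasDerivAt_pow n y).const_mul (a n)) (fun n y hy => ?_) ⟨h0, hxr⟩ ?_ ⟨h0, hxr⟩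
  · have hy0 := hy.1.le
    rw [norm_mul, Real.norm_eq_abs, Real.norm_of_nonneg (by positivity)]
    calc |a n| * (n * y ^ (n - 1)) ≤ 1 * (n * r ^ (n - 1)) := by
          gcongr
          · exact ha n
          · exact hy.2.le
      _ = n * r ^ (n - 1) := one_mul _
  · refine Summable.of_norm_bounded (summable_geometric_of_lt_one h0.le h1) fun n => ?_
    rw [norm_mul, Real.norm_eq_abs, Real.norm_of_nonneg (by positivity)]
    exact mul_le_of_le_one_left (by positivity) (ha n)

theorem sum_range_mul_pow_pred_sub (x : ℝ) (k : ℕ) :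
    ∑ n ∈ Finset.range k, ((1 - x) * (n * x ^ (n - 1)) - x ^ n) = -(k * x ^ (k - 1)) := by
  induction k with
  | zero => simp
  | succ k ih =>
    rw [Finset.sum_range_succ, ih]
    cases k with
    | zero => simp
    | succ k => simp only [Nat.add_sub_cancel]; push_cast; ring

theorem abs_le_of_hasSum_of_sign_change {a d : ℕ → ℝ} {s e : ℝ} {k : ℕ}
    (ha : ∀ n, 0 ≤ a n ∧ a n ≤ 1) (hneg : ∀ n < k, d n ≤ 0) (hpos : ∀ n, k ≤ n → 0 ≤ d n)
    (hd : HasSum d 0) (he : ∑ n ∈ Finset.range k, d n = -e)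
    (hs : HasSum (fun n => a n * d n) s) : |s| ≤ e := by
  have hlow : HasSum (fun n => if n < k then d n else 0) (-e) := by
    rw [← he, ← Finset.sum_congr rfl fun n hn => if_pos (Finset.mem_range.1 hn)]
    exact hasSum_sum_of_ne_finset_zero fun n hn => if_neg (by simpa using hn)
  have hupp := hd.sub hlow
  rw [zero_sub, neg_neg] at hupp
  refine abs_le.2 ⟨hasSum_le (fun n => ?_) hlow hs, hasSum_le (fun n => ?_) hs hupp⟩
  · obtain ⟨h0, h1⟩ := ha n
    split_ifs with h
    · nlinarith [hneg n h]
    · exact mul_nonneg h0 (hpos n (not_lt.1 h))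
  · obtain ⟨h0, h1⟩ := ha n
    split_ifs with h
    · nlinarith [hneg n h]
    · nlinarith [hpos n (not_lt.1 h)]

theorem mul_pow_pred_sub_eq {x : ℝ} (hx : x ≠ 0) (n : ℕ) :
    (1 - x) * (n * x ^ (n - 1)) - x ^ n = x ^ n / x * (n - (n + 1) * x) := by
  cases n with
  | zero => simp [hx]
  | succ n => simp only [Nat.add_sub_cancel, pow_succ]; field_simp; ring

theorem stmt12 (ι : ℕ → ℝ) (hι : ∀ n, ι n = 0 ∨ ι n = 1)
    (g : ℝ → ℝ)
    (hg : ∀ x ∈ Set.Ioo (0 : ℝ) 1, g x = (1 - x) * ∑' n : ℕ, ι (n + 1) * x ^ n)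
    (k : ℕ) (hk : 2 ≤ k) (x : ℝ)
    (hx : x ∈ Set.Ico (1 - 1 / (k : ℝ)) (1 - 1 / ((k : ℝ) + 1))) :
    ∃ g' : ℝ, HasDerivAt g g' x ∧ |g'| ≤ (k : ℝ) * x ^ (k - 1) := by
  obtain ⟨hxl, hxu⟩ := hx
  have hk2 : (2 : ℝ) ≤ k := by exact_mod_cast hk
  have hkx : (k : ℝ) - 1 ≤ k * x := by
    have := mul_le_mul_of_nonneg_left hxl (show (0 : ℝ) ≤ k by linarith)
    rwa [mul_sub, mul_one, mul_one_div_cancel (by linarith)] at this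
  have hkx' : ((k : ℝ) + 1) * x ≤ k := by
    have := mul_le_mul_of_nonneg_left hxu.le (show (0 : ℝ) ≤ k + 1 by linarith)
    rw [mul_sub, mul_one, mul_one_div_cancel (by linarith)] at this
    linarith
  have h0 : 0 < x := by
    by_contra! h
    nlinarith
  have h1 : x < 1 := hxu.trans (sub_lt_self _ (by positivity))
  have ha : ∀ n, 0 ≤ ι (n + 1) ∧ ι (n + 1) ≤ 1 := fun n => by
    rcases hι (n + 1) with h | h <;> simp [h]
  have ha' : ∀ n, ‖ι (n + 1)‖ ≤ 1 := fun n => abs_le.2 ⟨by linarith [(ha n).1], (ha n).2⟩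
  have hpow := hasSum_geometric_of_lt_one h0.le h1
  have hder := hasSum_nat_mul_pow_pred h0 h1
  have hs₀ : Summable fun n => ι (n + 1) * x ^ n :=
    .of_norm_bounded hpow.summable fun n => by
      rw [norm_mul, Real.norm_of_nonneg (by positivity : 0 ≤ x ^ n)]
      exact mul_le_of_le_one_left (by positivity) (ha' n)
  have hs₁ : Summable fun n : ℕ => ι (n + 1) * (n * x ^ (n - 1)) :=
    .of_norm_bounded hder.summable fun n => by
      rw [norm_mul, Real.norm_of_nonneg (by positivity : 0 ≤ (n : ℝ) * x ^ (n - 1))]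
      exact mul_le_of_le_one_left (by positivity) (ha' n)
  refine ⟨_, (((hasDerivAt_id x).const_sub 1).mul
    (hasDerivAt_tsum_mul_pow ha' h0 h1)).congr_of_eventuallyEq
    (Filter.eventuallyEq_of_mem (Ioo_mem_nhds h0 h1) hg), ?_⟩
  refine abs_le_of_hasSum_of_sign_change (k := k) ha
    (d := fun n : ℕ => (1 - x) * (n * x ^ (n - 1)) - x ^ n)
    (fun n hn => ?_) (fun n hn => ?_) ?_ (sum_range_mul_pow_pred_sub x k) ?_
  · have hn' : (n : ℝ) + 1 ≤ k := by exact_mod_cast hn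
    rw [mul_pow_pred_sub_eq h0.ne']
    exact mul_nonpos_of_nonneg_of_nonpos (by positivity) (by nlinarith)
  · have hn' : (k : ℝ) ≤ n := by exact_mod_cast hn
    rw [mul_pow_pred_sub_eq h0.ne']
    exact mul_nonneg (by positivity) (by nlinarith)
  · have h := (hder.mul_left (1 - x)).sub hpow
    have hx1 : 1 - x ≠ 0 := by linarith
    rwa [show (1 - x) * (1 / (1 - x) ^ 2) - (1 - x)⁻¹ = 0 by field_simp; ring] at h
  · have h := (hs₁.hasSum.mul_left (1 - x)).sub hs₀.hasSum
    rw [sub_eq_neg_add _ (tsum _), ← neg_one_mul] at h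
    refine (congrArg (HasSum · _) (funext fun n => ?_)).mp h
    ring
end

section
/- Let √2 ≤ β < β' ≤ 2. Then for every ε = (ε_n)_{n≥0} ∈ {0,1}^ℕ: |π_β(ε) − π_{β'}(ε)| ≤ 2β^{-3}(β' − β) if β > 1.5, and |π_β(ε) − π_{β'}(ε)| ≤ 3β^{-4}(β' − β) if β ≤ 1.5, where π_β(ε) = (1 − 1/β) ∑_{n≥0} ε_n β^{-n}. -/
open MeasureTheory Filter Topology

theorem hasSum_pow_sub_pow_succ {u : ℝ} (hu0 : 0 ≤ u) (hu1 : u < 1) :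
    HasSum (fun n : ℕ => u ^ n - u ^ (n + 1)) 1 := by
  have h := (hasSum_geometric_of_lt_one hu0 hu1).mul_left (1 - u)
  rw [mul_inv_cancel₀ (by linarith)] at h
  refine h.congr_fun fun n => ?_
  ring

/-- The coding map as an absolutely convergent series in `1 / β`. -/
theorem hasSum_piBeta {β : ℝ} (hβ : 1 < β) (x : ℕ → Fin 2) :
    HasSum (fun n : ℕ => ((x n : ℕ) : ℝ) * ((1 / β) ^ n - (1 / β) ^ (n + 1)))
      (piBeta β x) := by
  have hβ0 : 0 < β := by linarith
  have hs : Summable fun n : ℕ => ((x n : ℕ) : ℝ) / β ^ n := by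
    refine Summable.of_nonneg_of_le (fun n => by positivity) (fun n => ?_)
      (summable_geometric_of_lt_one (r := 1 / β) (by positivity) ((div_lt_one hβ0).2 hβ))
    have hx : ((x n : ℕ) : ℝ) ≤ 1 := by
      exact_mod_cast Nat.lt_succ_iff.1 (x n).isLt
    rw [one_div_pow]
    gcongr
  refine (hs.hasSum.mul_left (1 - 1 / β)).congr_fun fun n => ?_
  rw [pow_succ, one_div_pow]
  ring

/-- If the increments of a pair of geometric distributions change sign exactly once, at `k`, then
the corresponding difference of `0`-`1` expansions is bounded by the difference of the tails. -/
theorem abs_sub_le_pow_sub_pow {u v a b : ℝ} (hv0 : 0 ≤ v) (hv1 : v < 1) (hu0 : 0 ≤ u)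
    (hu1 : u < 1) (x : ℕ → Fin 2)
    (ha : HasSum (fun n : ℕ => ((x n : ℕ) : ℝ) * (u ^ n - u ^ (n + 1))) a)
    (hb : HasSum (fun n : ℕ => ((x n : ℕ) : ℝ) * (v ^ n - v ^ (n + 1))) b) (k : ℕ)
    (hlt : ∀ n < k, u ^ n - u ^ (n + 1) ≤ v ^ n - v ^ (n + 1))
    (hge : ∀ n ≥ k, v ^ n - v ^ (n + 1) ≤ u ^ n - u ^ (n + 1)) :
    |a - b| ≤ u ^ k - v ^ k := by
  have hx0 : ∀ n, (0 : ℝ) ≤ ((x n : ℕ) : ℝ) := fun n => by positivity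
  have hx1 : ∀ n, ((x n : ℕ) : ℝ) ≤ 1 := fun n => by
    exact_mod_cast Nat.lt_succ_iff.1 (x n).isLt
  have hd := (hasSum_pow_sub_pow_succ hu0 hu1).sub (hasSum_pow_sub_pow_succ hv0 hv1)
  have htail := (hasSum_nat_add_iff' k).2 hd
  have hab := (hasSum_nat_add_iff' k).2 (ha.sub hb)
  have hsum : ∑ i ∈ Finset.range k, (u ^ i - u ^ (i + 1) - (v ^ i - v ^ (i + 1)))
      = v ^ k - u ^ k := by
    rw [Finset.sum_sub_distrib, Finset.sum_range_sub', Finset.sum_range_sub']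
    ring
  rw [hsum] at htail
  have hheadle : ∑ i ∈ Finset.range k, (((x i : ℕ) : ℝ) * (u ^ i - u ^ (i + 1)) -
      ((x i : ℕ) : ℝ) * (v ^ i - v ^ (i + 1))) ≤ 0 := by
    refine Finset.sum_nonpos fun i hi => ?_
    nlinarith [hlt i (Finset.mem_range.1 hi), hx0 i]
  have hheadge : v ^ k - u ^ k ≤ ∑ i ∈ Finset.range k,
      (((x i : ℕ) : ℝ) * (u ^ i - u ^ (i + 1)) -
      ((x i : ℕ) : ℝ) * (v ^ i - v ^ (i + 1))) := by
    rw [← hsum]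
    refine Finset.sum_le_sum fun i hi => ?_
    nlinarith [hlt i (Finset.mem_range.1 hi), hx1 i]
  have htaille := hasSum_le (fun n => by
    nlinarith [hge (n + k) (Nat.le_add_left k n), hx1 (n + k)]) hab htail
  have htailge := hab.nonneg (fun n => by
    nlinarith [hge (n + k) (Nat.le_add_left k n), hx0 (n + k)])
  rw [abs_le]
  constructor <;> linarith

theorem pow_sub_pow_succ_le_of_le {u v : ℝ} (hv0 : 0 ≤ v) (hvu : v ≤ u) (hv1 : v ≤ 1) {k : ℕ}
    (hk : v ^ k - v ^ (k + 1) ≤ u ^ k - u ^ (k + 1)) {n : ℕ} (hn : k ≤ n) :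
    v ^ n - v ^ (n + 1) ≤ u ^ n - u ^ (n + 1) := by
  induction n, hn using Nat.le_induction with
  | base => exact hk
  | succ n _ ih =>
    have h0 : 0 ≤ v ^ n - v ^ (n + 1) := sub_nonneg.2 (pow_le_pow_of_le_one hv0 hv1 n.le_succ)
    calc v ^ (n + 1) - v ^ (n + 1 + 1) = v * (v ^ n - v ^ (n + 1)) := by ring
      _ ≤ u * (u ^ n - u ^ (n + 1)) := mul_le_mul hvu ih h0 (hv0.trans hvu)
      _ = u ^ (n + 1) - u ^ (n + 1 + 1) := by ring

theorem sq_sub_cube_le {u v : ℝ} (hv0 : 0 ≤ v) (hvu : v ≤ u) (hu : u ≤ 2 / 3) :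
    v ^ 2 - v ^ 3 ≤ u ^ 2 - u ^ 3 := by
  have h : 0 ≤ (u + v) - (u ^ 2 + u * v + v ^ 2) := by
    nlinarith [mul_nonneg (add_nonneg (hv0.trans hvu) hv0) (sub_nonneg.2 hu),
      mul_nonneg hv0 (sub_nonneg.2 hvu), mul_self_nonneg (u - v)]
  nlinarith [mul_nonneg (sub_nonneg.2 hvu) h]

theorem cube_sub_pow_four_le {u v : ℝ} (hv0 : 0 ≤ v) (hvu : v ≤ u) (hu : u ≤ 3 / 4) :
    v ^ 3 - v ^ 4 ≤ u ^ 3 - u ^ 4 := by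
  have hu0 := hv0.trans hvu
  have h1 : 0 ≤ (u ^ 2 + u * v + v ^ 2) * (3 / 4 - u) :=
    mul_nonneg (by positivity) (sub_nonneg.2 hu)
  have h2 : 0 ≤ (u - v) * (u ^ 2 + 2 * u * v + 3 * v ^ 2) :=
    mul_nonneg (sub_nonneg.2 hvu) (by positivity)
  have h : 0 ≤ (u ^ 2 + u * v + v ^ 2) - (u + v) * (u ^ 2 + v ^ 2) := by linarith
  linarith [mul_nonneg (sub_nonneg.2 hvu) h]

theorem stmt13 (β β' : ℝ) (h1 : Real.sqrt 2 ≤ β) (h2 : β < β') (h3 : β' ≤ 2)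
    (x : ℕ → Fin 2) :
    (1.5 < β → |piBeta β x - piBeta β' x| ≤ 2 / β ^ 3 * (β' - β)) ∧
    (β ≤ 1.5 → |piBeta β x - piBeta β' x| ≤ 3 / β ^ 4 * (β' - β)) := by
  have hβ : (4 / 3 : ℝ) ≤ β := (Real.le_sqrt' (by norm_num)).2 (by norm_num) |>.trans h1
  have hβ0 : 0 < β := by linarith
  have hβ'0 : 0 < β' := by linarith
  have hpu := hasSum_piBeta (by linarith : 1 < β) x
  have hpv := hasSum_piBeta (by linarith : 1 < β') x
  have hdiff : 1 / β - 1 / β' = (1 / β) * (1 / β') * (β' - β) := by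
    field_simp
  have hvu : 1 / β' < 1 / β := one_div_lt_one_div_of_lt hβ0 h2
  have hv : 1 / 2 ≤ 1 / β' := one_div_le_one_div_of_le hβ'0 h3
  have hu : 1 / β ≤ 3 / 4 := by
    rw [div_le_iff₀ hβ0]
    linarith
  have hc2 : 2 / β ^ 3 = 2 * (1 / β) ^ 3 := by rw [one_div_pow]; ring
  have hc3 : 3 / β ^ 4 = 3 * (1 / β) ^ 4 := by rw [one_div_pow]; ring
  have hu23 : 1.5 < β → 1 / β ≤ 2 / 3 := fun h => by
    rw [div_le_iff₀ hβ0]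
    norm_num at h
    linarith
  have hu32 : β ≤ 1.5 → 2 / 3 ≤ 1 / β := fun h => by
    rw [le_div_iff₀ hβ0]
    norm_num at h
    linarith
  rw [hc2, hc3]
  clear hc2 hc3 h1
  generalize 1 / β = u at *
  generalize 1 / β' = v at *
  have hv0 : 0 ≤ v := by linarith
  have hu0 : 0 ≤ u := by linarith
  have hδ : 0 ≤ β' - β := by linarith
  have hd0 : u ^ 0 - u ^ (0 + 1) ≤ v ^ 0 - v ^ (0 + 1) := by
    simp only [pow_zero, zero_add, pow_one]
    linarith
  have hd1 : u ^ 1 - u ^ (1 + 1) ≤ v ^ 1 - v ^ (1 + 1) := by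
    have h := mul_nonneg (sub_nonneg.2 hvu.le) (by linarith : 0 ≤ u + v - 1)
    norm_num
    linarith
  have hd3 := cube_sub_pow_four_le hv0 hvu.le hu
  have hsq : u ^ 2 - v ^ 2 = u * (v * (u + v)) * (β' - β) := by
    linear_combination (u + v) * hdiff
  have hcube : u ^ 3 - v ^ 3 = u * (v * (u ^ 2 + u * v + v ^ 2)) * (β' - β) := by
    linear_combination (u ^ 2 + u * v + v ^ 2) * hdiff
  have hvuu : v * (u + v) ≤ 2 * u ^ 2 := by nlinarith
  have htwo (hd2 : v ^ 2 - v ^ 3 ≤ u ^ 2 - u ^ 3) :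
      |piBeta β x - piBeta β' x| ≤ u * (2 * u ^ 2) * (β' - β) := by
    refine (abs_sub_le_pow_sub_pow hv0 (by linarith) hu0 (by linarith) x hpu hpv 2 ?_
      fun n hn => pow_sub_pow_succ_le_of_le hv0 hvu.le (by linarith) hd2 hn).trans ?_
    · intro n hn
      interval_cases n
      exacts [hd0, hd1]
    · rw [hsq]
      gcongr
  refine ⟨fun h => ?_, fun h => ?_⟩
  · refine (htwo (sq_sub_cube_le hv0 hvu.le (hu23 h))).trans_eq (by ring)
  · rcases le_total (v ^ 2 - v ^ 3) (u ^ 2 - u ^ 3) with hd2 | hd2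
    · refine (htwo hd2).trans ?_
      refine mul_le_mul_of_nonneg_right ?_ hδ
      nlinarith [mul_nonneg (pow_nonneg hu0 3) (sub_nonneg.2 (hu32 h))]
    · refine (abs_sub_le_pow_sub_pow hv0 (by linarith) hu0 (by linarith) x hpu hpv 3 ?_
        fun n hn => pow_sub_pow_succ_le_of_le hv0 hvu.le (by linarith) hd3 hn).trans ?_
      · intro n hn
        interval_cases n
        exacts [hd0, hd1, hd2]
      · rw [hcube]
        refine mul_le_mul_of_nonneg_right ?_ hδ
        calc u * (v * (u ^ 2 + u * v + v ^ 2)) ≤ u * (u * (u ^ 2 + u * u + u ^ 2)) := by gcongr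
          _ = 3 * u ^ 4 := by ring
end

section
/- Let n ≥ 2 be an integer and let β_n ∈ (1,2) satisfy β_n^n = β_n^{n−1} + β_n^{n−2} + ⋯ + β_n + 1. Then for every β with β_n ≤ β < 2: μ_β([0, β − 1]) ≥ (2^n − 2)/(2^n − 1). -/
open MeasureTheory Filter Topology

theorem abs_digit_div_pow_le {β : ℝ} (hβ : 1 < β) (d : Fin 2) (i : ℕ) :
    ‖((d : ℕ) : ℝ) / β ^ i‖ ≤ (1 / β) ^ i := by
  have h0 : 0 < β := by linarith
  have h1 : ((d : ℕ) : ℝ) ≤ 1 := by exact_mod_cast Nat.lt_succ_iff.mp d.2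
  rw [Real.norm_of_nonneg (by positivity), div_pow, one_pow]
  gcongr

theorem summable_one_div_pow {β : ℝ} (hβ : 1 < β) : Summable fun i : ℕ => (1 / β) ^ i :=
  summable_geometric_of_lt_one (by positivity) ((div_lt_one (by linarith)).2 hβ)

theorem summable_digit_div_pow {β : ℝ} (hβ : 1 < β) (x : ℕ → Fin 2) :
    Summable fun i : ℕ => ((x i : ℕ) : ℝ) / β ^ i :=
  (summable_one_div_pow hβ).of_norm_bounded fun i => abs_digit_div_pow_le hβ (x i) i

theorem piBeta_nonneg {β : ℝ} (hβ : 1 < β) (x : ℕ → Fin 2) : 0 ≤ piBeta β x := by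
  have h : 1 / β < 1 := (div_lt_one (by linarith)).2 hβ
  exact mul_nonneg (by linarith) (tsum_nonneg fun i => by positivity)

theorem piBeta_le_one {β : ℝ} (hβ : 1 < β) (x : ℕ → Fin 2) : piBeta β x ≤ 1 := by
  have h : 1 / β < 1 := (div_lt_one (by linarith)).2 hβ
  have h1 : ∑' i : ℕ, ((x i : ℕ) : ℝ) / β ^ i ≤ (1 - 1 / β)⁻¹ := by
    rw [← tsum_geometric_of_lt_one (by positivity) h]
    exact (summable_digit_div_pow hβ x).tsum_le_tsum
      (fun i => (le_abs_self _).trans (abs_digit_div_pow_le hβ (x i) i)) (summable_one_div_pow hβ)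
  calc piBeta β x ≤ (1 - 1 / β) * (1 - 1 / β)⁻¹ :=
        mul_le_mul_of_nonneg_left h1 (by linarith)
    _ = 1 := mul_inv_cancel₀ (by linarith)

theorem piBeta_eq_shift {β : ℝ} (hβ : 1 < β) (x : ℕ → Fin 2) :
    piBeta β x = (1 - 1 / β) * ((x 0 : ℕ) : ℝ) + piBeta β (fun i => x (i + 1)) / β := by
  have h0 : β ≠ 0 := by linarith
  have h : ∑' i : ℕ, ((x (i + 1) : ℕ) : ℝ) / β ^ (i + 1)
      = (∑' i : ℕ, ((x (i + 1) : ℕ) : ℝ) / β ^ i) / β := by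
    rw [← tsum_div_const]
    exact tsum_congr fun i => by rw [pow_succ, div_div]
  unfold piBeta
  rw [(summable_digit_div_pow hβ x).tsum_eq_zero_add, h]
  simp only [pow_zero, div_one]
  ring

/-- One step of the expansion of `1 - π_β`: its shift is obtained by multiplying by `β` and
subtracting `β - 1` for a digit `0`. -/
theorem one_sub_piBeta_shift {β : ℝ} (hβ : 1 < β) (x : ℕ → Fin 2) (k : ℕ) :
    1 - piBeta β (fun i => x (i + (k + 1))) =
      β * (1 - piBeta β (fun i => x (i + k))) - (β - 1) * (1 - ((x k : ℕ) : ℝ)) := by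
  have h0 : β ≠ 0 := by linarith
  have h := piBeta_eq_shift hβ (fun i => x (i + k))
  simp only [zero_add, add_assoc, add_comm 1 k] at h
  rw [h]
  field_simp
  ring

/-- If `β ^ n * (2 - β) ≤ 1` and `β` is at least the golden ratio, a sequence coding a point above
`β - 1` starts with `n - 1` ones, and if the next digit is `0` then the remaining tail again
codes a point above `β - 1`. -/
theorem digits_of_lt_piBeta {β : ℝ} {n : ℕ} (hβ : 1 < β) (hgold : β + 1 ≤ β ^ 2)
    (hpow : β ^ n * (2 - β) ≤ 1) (hn : 2 ≤ n) {x : ℕ → Fin 2} (hx : β - 1 < piBeta β x) :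
    (∀ j < n - 1, x j = 1) ∧
      (x (n - 1) = 1 ∨ x (n - 1) = 0 ∧ β - 1 < piBeta β (fun i => x (i + n))) := by
  have key : ∀ k ≤ n - 1, (∀ j < k, x j = 1) ∧
      1 - piBeta β (fun i => x (i + k)) < β ^ k * (2 - β) := by
    intro k
    induction k with
    | zero => exact fun _ => ⟨by simp, by simp; linarith⟩
    | succ k ih =>
      intro hk
      obtain ⟨h1, h2⟩ := ih (by omega)
      have hs := one_sub_piBeta_shift hβ x k
      have hle := piBeta_le_one hβ (fun i => x (i + (k + 1)))
      have hxk : x k = 1 := by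
        by_contra hne
        have h0 : x k = 0 := by omega
        rw [h0] at hs
        simp only [Fin.val_zero, Nat.cast_zero, sub_zero, mul_one] at hs
        have hpos : 0 < 2 - β := by
          have : 0 < β ^ k * (2 - β) := by
            nlinarith [piBeta_le_one hβ (fun i => x (i + k))]
          exact pos_of_mul_pos_right this (by positivity)
        have h3 : β ^ 2 * (β ^ k * (2 - β)) ≤ 1 := by
          refine le_trans ?_ hpow
          rw [← mul_assoc, ← pow_add]
          gcongr
          · exact hβ.le
          · omega
        nlinarith
      refine ⟨fun j hj => ?_, ?_⟩
      · rcases Nat.lt_succ_iff_lt_or_eq.mp hj with h | rfl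
        · exact h1 j h
        · exact hxk
      · rw [hs, hxk, pow_succ]
        simp only [Fin.val_one, Nat.cast_one, sub_self, mul_zero, sub_zero]
        nlinarith
  obtain ⟨h1, h2⟩ := key (n - 1) le_rfl
  refine ⟨h1, ?_⟩
  by_cases h : x (n - 1) = 1
  · exact Or.inl h
  · have h0 : x (n - 1) = 0 := by omega
    refine Or.inr ⟨h0, ?_⟩
    have hs := one_sub_piBeta_shift hβ x (n - 1)
    rw [h0, Nat.sub_add_cancel (by omega)] at hs
    simp only [Fin.val_zero, Nat.cast_zero, sub_zero, mul_one] at hs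
    have hp : β ^ n = β * β ^ (n - 1) := by
      rw [← pow_succ', Nat.sub_add_cancel (by omega)]
    rw [hp] at hpow
    nlinarith

theorem IsCoinMeasure.measureReal_cylinder {m : Measure (ℕ → Fin 2)} (hm : IsCoinMeasure m)
    (l : ℕ) (v : ℕ → Fin 2) : m.real {x | ∀ j < l, x j = v j} = (1 / 2 : ℝ) ^ l := by
  have h := hm.2 l (fun j => v j)
  have hs : {x : ℕ → Fin 2 | ∀ j : Fin l, x j.1 = v j} = {x | ∀ j < l, x j = v j} := by
    ext x
    exact Fin.forall_iff
  rw [hs] at h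
  simp [measureReal_def, h]

/-- If every sequence in `A` either starts with the word `u` of length `n`, or starts with the
word `w` of length `n` and has its remaining tail in `A`, then `A` has mass at most
`1 / (2 ^ n - 1)`; the approximate version, relative to a cylinder. -/
theorem IsCoinMeasure.measureReal_cylinder_inter_le {m : Measure (ℕ → Fin 2)}
    (hm : IsCoinMeasure m) {n : ℕ} (hn : n ≠ 0) {A : Set (ℕ → Fin 2)} {u w : ℕ → Fin 2}
    (hA : ∀ x ∈ A, (∀ j < n, x j = u j) ∨ (∀ j < n, x j = w j) ∧ (fun i => x (i + n)) ∈ A)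
    (k l : ℕ) (v : ℕ → Fin 2) :
    m.real {x | (∀ j < l, x j = v j) ∧ (fun i => x (i + l)) ∈ A} ≤
      (1 / 2 : ℝ) ^ l * (1 / (2 ^ n - 1) + ((1 / 2 : ℝ) ^ n) ^ k) := by
  have := hm.1
  have h2 : (1 : ℝ) < 2 ^ n := one_lt_pow₀ (by norm_num) hn
  have hc : (0 : ℝ) < 1 / (2 ^ n - 1) := one_div_pos.2 (by linarith)
  induction k generalizing l v with
  | zero =>
    refine (measureReal_mono (fun x hx => hx.1) (measure_ne_top _ _)).trans
      ((hm.measureReal_cylinder l v).trans_le ?_)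
    exact le_mul_of_one_le_right (by positivity) (by simp; simpa using hc.le)
  | succ k ih =>
    let glue (t : ℕ → Fin 2) (j : ℕ) : Fin 2 := if j < l then v j else t (j - l)
    have hglue : ∀ (t x : ℕ → Fin 2), (∀ j < l, x j = v j) → (∀ j < n, x (j + l) = t j) →
        ∀ j < l + n, x j = glue t j := by
      intro t x h1 h3 j hj
      by_cases h : j < l
      · simp [glue, h, h1 j h]
      · have := h3 (j - l) (by omega)
        rw [Nat.sub_add_cancel (by omega)] at this
        simp [glue, h, this]
    have hsub : {x : ℕ → Fin 2 | (∀ j < l, x j = v j) ∧ (fun i => x (i + l)) ∈ A} ⊆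
        {x : ℕ → Fin 2 | ∀ j < l + n, x j = glue u j} ∪
        {x : ℕ → Fin 2 | (∀ j < l + n, x j = glue w j) ∧ (fun i => x (i + (l + n))) ∈ A} := by
      rintro x ⟨h1, h3⟩
      rcases hA _ h3 with h | ⟨h, h'⟩
      · exact Or.inl (hglue u x h1 h)
      · refine Or.inr ⟨hglue w x h1 h, ?_⟩
        simpa only [add_assoc, add_comm n l] using h'
    calc m.real {x | (∀ j < l, x j = v j) ∧ (fun i => x (i + l)) ∈ A}
        ≤ (1 / 2 : ℝ) ^ (l + n) +
          (1 / 2 : ℝ) ^ (l + n) * (1 / (2 ^ n - 1) + ((1 / 2 : ℝ) ^ n) ^ k) :=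
          (measureReal_mono hsub (measure_ne_top _ _)).trans <| (measureReal_union_le _ _).trans <|
            add_le_add (hm.measureReal_cylinder _ _).le (ih _ _)
      _ = (1 / 2 : ℝ) ^ l * (1 / (2 ^ n - 1) + ((1 / 2 : ℝ) ^ n) ^ (k + 1)) := by
          have h3 : (2 : ℝ) ^ n - 1 ≠ 0 := by linarith
          have h4 : (1 / 2 : ℝ) ^ n * (1 + 1 / (2 ^ n - 1)) = 1 / (2 ^ n - 1) := by
            rw [one_div_pow]
            field_simp
            ring
          rw [pow_add, pow_succ _ k]
          linear_combination (1 / 2 : ℝ) ^ l * h4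

theorem IsCoinMeasure.measureReal_le {m : Measure (ℕ → Fin 2)}
    (hm : IsCoinMeasure m) {n : ℕ} (hn : n ≠ 0) {A : Set (ℕ → Fin 2)} {u w : ℕ → Fin 2}
    (hA : ∀ x ∈ A, (∀ j < n, x j = u j) ∨ (∀ j < n, x j = w j) ∧ (fun i => x (i + n)) ∈ A) :
    m.real A ≤ 1 / (2 ^ n - 1) := by
  have hlim : Tendsto (fun k : ℕ => 1 / ((2 : ℝ) ^ n - 1) + ((1 / 2 : ℝ) ^ n) ^ k) atTop
      (𝓝 (1 / (2 ^ n - 1) + 0)) :=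
    (tendsto_pow_atTop_nhds_zero_of_lt_one (by positivity)
      (pow_lt_one₀ (by norm_num) (by norm_num) hn)).const_add _
  rw [add_zero] at hlim
  have hset : {x : ℕ → Fin 2 | (∀ j < 0, x j = u j) ∧ (fun i => x (i + 0)) ∈ A} = A := by
    ext x
    exact ⟨fun h => h.2, fun h => ⟨by simp, h⟩⟩
  refine ge_of_tendsto' hlim fun k => ?_
  have h := hm.measureReal_cylinder_inter_le hn hA k 0 u
  rwa [hset, pow_zero, one_mul] at h

theorem sum_pow_le_pow_of_le {a b : ℝ} {n : ℕ} (ha : 0 < a) (hab : a ≤ b)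
    (h : ∑ j ∈ Finset.range n, a ^ j ≤ a ^ n) : ∑ j ∈ Finset.range n, b ^ j ≤ b ^ n := by
  have hb : 0 < b := ha.trans_le hab
  have h1 : a ^ n * ∑ j ∈ Finset.range n, b ^ j ≤ b ^ n * ∑ j ∈ Finset.range n, a ^ j := by
    rw [Finset.mul_sum, Finset.mul_sum]
    refine Finset.sum_le_sum fun j hj => ?_
    have hjn : n = (n - j) + j := by have := Finset.mem_range.mp hj; omega
    calc a ^ n * b ^ j = a ^ (n - j) * (a ^ j * b ^ j) := by
          conv_lhs => rw [hjn, pow_add]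
          ring
      _ ≤ b ^ (n - j) * (a ^ j * b ^ j) := by gcongr
      _ = b ^ n * a ^ j := by
          conv_rhs => rw [hjn, pow_add]
          ring
  have h2 : a ^ n * ∑ j ∈ Finset.range n, b ^ j ≤ a ^ n * b ^ n :=
    h1.trans (by rw [mul_comm (a ^ n)]; gcongr)
  exact le_of_mul_le_mul_left h2 (by positivity)

theorem add_one_le_sq_of_sum_pow_le {b : ℝ} {n : ℕ} (hb : 0 < b) (hn : 2 ≤ n)
    (h : ∑ j ∈ Finset.range n, b ^ j ≤ b ^ n) : b + 1 ≤ b ^ 2 := by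
  obtain ⟨k, rfl⟩ := Nat.exists_eq_add_of_le' hn
  rw [Finset.sum_range_succ, Finset.sum_range_succ] at h
  have h0 : 0 ≤ ∑ j ∈ Finset.range k, b ^ j := Finset.sum_nonneg fun j _ => by positivity
  have hk : 0 < b ^ k := by positivity
  refine le_of_mul_le_mul_left ?_ hk
  rw [pow_add, pow_add, pow_one] at h
  linarith

theorem stmt17 (n : ℕ) (hn : 2 ≤ n) (βn : ℝ) (hβ1 : 1 < βn) (hβ2 : βn < 2)
    (hroot : βn ^ n = ∑ j ∈ Finset.range n, βn ^ j)
    (β : ℝ) (hβn : βn ≤ β) (hβ : β < 2)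
    (m : Measure (ℕ → Fin 2)) (hm : IsCoinMeasure m) :
    ((2 : ℝ) ^ n - 2) / ((2 : ℝ) ^ n - 1) ≤
      ((m.map (piBeta β)) (Set.Icc (0 : ℝ) (β - 1))).toReal := by
  have := hm.1
  have hb : 1 < β := hβ1.trans_le hβn
  have hsum := sum_pow_le_pow_of_le (by linarith) hβn hroot.ge
  have hgold := add_one_le_sq_of_sum_pow_le (by linarith) hn hsum
  have hpow : β ^ n * (2 - β) ≤ 1 := by
    have h := mul_le_mul_of_nonneg_right hsum (sub_nonneg.2 hb.le)
    rw [geom_sum_mul] at h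
    linarith
  have hmeas : Measurable (piBeta β) := (continuous_piBeta hb).measurable
  have hA : m.real {x | β - 1 < piBeta β x} ≤ 1 / (2 ^ n - 1) := by
    refine hm.measureReal_le (u := fun _ => 1) (w := fun j => if j < n - 1 then 1 else 0)
      (by omega) fun x hx => ?_
    obtain ⟨h1, h2⟩ := digits_of_lt_piBeta hb hgold hpow hn hx
    rcases h2 with h2 | ⟨h2, h3⟩
    · refine Or.inl fun j hj => ?_
      rcases Nat.lt_or_ge j (n - 1) with h | h
      · exact h1 j h
      · rwa [show j = n - 1 by omega]
    · refine Or.inr ⟨fun j hj => ?_, h3⟩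
      rcases Nat.lt_or_ge j (n - 1) with h | h
      · simp [h, h1 j h]
      · simp [show j = n - 1 by omega, h2]
  have hpre : piBeta β ⁻¹' Set.Icc 0 (β - 1) = {x | β - 1 < piBeta β x}ᶜ := by
    ext x
    simp [piBeta_nonneg hb x]
  rw [Measure.map_apply hmeas measurableSet_Icc, hpre, ← measureReal_def,
    probReal_compl_eq_one_sub (measurableSet_lt measurable_const hmeas)]
  have h2 : (1 : ℝ) < 2 ^ n := one_lt_pow₀ (by norm_num) (by omega)
  have h3 : ((2 : ℝ) ^ n - 2) / (2 ^ n - 1) = 1 - 1 / (2 ^ n - 1) := by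
    have : (2 : ℝ) ^ n - 1 ≠ 0 := by linarith
    field_simp
    ring
  linarith
end

section
/- Let n ≥ 2 be an integer, let β_n ∈ (1,2) satisfy β_n^n = β_n^{n−1} + ⋯ + β_n + 1, and let β ∈ [β_n, 2). Then: (a) β(β^{n−1} − β^{n−2} − ⋯ − β − 1) ≥ 1; and (b) if n ≥ 3, then for each i with 1 ≤ i ≤ n − 2: β(β − 1)(β^i − β^{i−1} − ⋯ − β − 1) ≥ 1. -/
/-- The telescoped form of `x ^ k - x ^ (k - 1) - ⋯ - x - 1`. -/
theorem sub_one_mul_pow_sub_geom_sum (x : ℝ) (k : ℕ) :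
    (x - 1) * (x ^ k - ∑ j ∈ Finset.range k, x ^ j) = 1 - x ^ k * (2 - x) := by
  have h := geom_sum_mul x k
  linear_combination -h

/-- Nonnegativity of `x ^ n - ∑ x ^ j` propagates to the right of a positive root. -/
theorem geom_sum_le_pow_of_root_le {n : ℕ} {x y : ℝ} (hx : 0 < x) (hxy : x ≤ y)
    (hroot : x ^ n = ∑ j ∈ Finset.range n, x ^ j) :
    ∑ j ∈ Finset.range n, y ^ j ≤ y ^ n := by
  have hy : 0 < y := hx.trans_le hxy
  refine le_of_mul_le_mul_left ?_ (pow_pos hx n)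
  calc x ^ n * ∑ j ∈ Finset.range n, y ^ j
      ≤ y ^ n * ∑ j ∈ Finset.range n, x ^ j := by
        rw [Finset.mul_sum, Finset.mul_sum]
        refine Finset.sum_le_sum fun j hj => ?_
        obtain ⟨k, rfl⟩ := Nat.exists_eq_add_of_le (Finset.mem_range.mp hj).le
        have hk : x ^ k ≤ y ^ k := by gcongr
        have h := mul_le_mul_of_nonneg_left hk (by positivity : 0 ≤ x ^ j * y ^ j)
        rw [pow_add, pow_add]
        linarith
    _ = x ^ n * y ^ n := by rw [← hroot, mul_comm]

theorem stmt18 (n : ℕ) (hn : 2 ≤ n) (βn : ℝ) (hβn1 : 1 < βn) (hβn2 : βn < 2)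
    (hroot : βn ^ n = ∑ j ∈ Finset.range n, βn ^ j)
    (β : ℝ) (hβ1 : βn ≤ β) (hβ2 : β < 2) :
    (1 ≤ β * (β ^ (n - 1) - ∑ j ∈ Finset.range (n - 1), β ^ j)) ∧
    (3 ≤ n → ∀ i : ℕ, 1 ≤ i → i ≤ n - 2 →
      1 ≤ β * (β - 1) * (β ^ i - ∑ j ∈ Finset.range i, β ^ j)) := by
  have hβ : 1 < β := hβn1.trans_le hβ1
  have hsum := geom_sum_le_pow_of_root_le (by linarith) hβ1 hroot
  constructor
  · obtain ⟨m, rfl⟩ : ∃ m, n = m + 1 := ⟨n - 1, by omega⟩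
    rw [geom_sum_succ, pow_succ] at hsum
    rw [Nat.add_sub_cancel]
    linarith
  · intro _ i _ hi
    have hpow : β ^ n * (2 - β) ≤ 1 := by
      have h := sub_one_mul_pow_sub_geom_sum β n
      have := mul_nonneg (sub_nonneg.mpr hβ.le) (sub_nonneg.mpr hsum)
      linarith
    have hle : ∀ k ≤ n, β ^ k * (2 - β) ≤ 1 := fun k hk =>
      (mul_le_mul_of_nonneg_right (pow_le_pow_right₀ hβ.le hk) (by linarith)).trans hpow
    have hgolden : 0 ≤ β ^ 2 - β - 1 := by
      have h := hle 2 hn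
      refine nonneg_of_mul_nonneg_right (?_ : 0 ≤ (β - 1) * _) (by linarith)
      linarith
    have h := hle (i + 2) (by omega)
    rw [mul_assoc, sub_one_mul_pow_sub_geom_sum]
    refine le_of_mul_le_mul_left ?_ (by linarith : 0 < β)
    rw [pow_add] at h
    linarith
end
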